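/- arXiv:1911.05315 — 9 statements merged into one kernel-verified Lean document; each statement's English description precedes it below -/
import Mathlib

section
/- If f(z) = Σ_{n=0}^∞ a_n z^n is analytic in the open unit disk 𝔻 with |f(z)| ≤ 1 for all z ∈ 𝔻, then for every r ∈ [0,1) one has Σ_{n=0}^∞ |a_n| r^n ≤ (1/(1-r)) · (1 - r · Σ_{n=0}^∞ |a_n|² r^{2n}). -/
open Complex in
/-- The character `θ ↦ exp (i k θ)`. -/
noncomputable def circleChar (k : ℤ) (θ : ℝ) : ℂ := exp ((k : ℂ) * θ * I)

@[fun_prop]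
lemma continuous_circleChar (k : ℤ) : Continuous (circleChar k) := by
  unfold circleChar; fun_prop

lemma circleChar_add (k l : ℤ) (θ : ℝ) :
    circleChar (k + l) θ = circleChar k θ * circleChar l θ := by
  simp only [circleChar, ← Complex.exp_add]
  congr 1; push_cast; ring

lemma circleChar_natCast (k : ℕ) (θ : ℝ) : circleChar k θ = circleChar 1 θ ^ k := by
  simp only [circleChar, ← Complex.exp_nat_mul]
  congr 1; push_cast; ring

lemma norm_circleChar (k : ℤ) (θ : ℝ) : ‖circleChar k θ‖ = 1 := by
  have := Complex.norm_exp_ofReal_mul_I (k * θ)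
  push_cast at this
  exact this

lemma conj_circleChar (k : ℤ) (θ : ℝ) :
    (starRingEnd ℂ) (circleChar k θ) = circleChar (-k) θ := by
  simp [circleChar, ← Complex.exp_conj]

lemma integral_circleChar (k : ℤ) :
    ∫ θ in (0 : ℝ)..2 * Real.pi, circleChar k θ = if k = 0 then (2 * Real.pi : ℂ) else 0 := by
  split_ifs with h
  · simp [circleChar, h]
  · have hk : (k : ℂ) * Complex.I ≠ 0 := mul_ne_zero (by exact_mod_cast h) Complex.I_ne_zero
    have := integral_exp_mul_complex (a := 0) (b := 2 * Real.pi) hk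
    have h2 : Complex.exp ((k : ℂ) * Complex.I * ((2 * Real.pi : ℝ) : ℂ)) = 1 := by
      rw [Complex.exp_eq_one_iff]
      exact ⟨k, by push_cast; ring⟩
    rw [h2] at this
    simp only [Complex.ofReal_zero, mul_zero, Complex.exp_zero, sub_self, zero_div] at this
    rw [← this]
    refine intervalIntegral.integral_congr fun θ _ => ?_
    simp only [circleChar]
    congr 1; ring

/-- Fourier coefficients of an absolutely convergent power series on the unit circle. -/
lemma integral_tsum_mul_circleChar {b : ℕ → ℂ} (hb : Summable fun n => ‖b n‖) (m : ℤ) :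
    ∫ θ in (0 : ℝ)..2 * Real.pi, (∑' k : ℕ, b k * circleChar k θ) * circleChar m θ =
      ∑' k : ℕ, b k * if (k : ℤ) + m = 0 then (2 * Real.pi : ℂ) else 0 := by
  have key := intervalIntegral.hasSum_integral_of_dominated_convergence (a := 0)
    (b := 2 * Real.pi) (μ := MeasureTheory.volume)
    (F := fun (k : ℕ) θ => b k * circleChar (k + m) θ)
    (f := fun θ => (∑' k : ℕ, b k * circleChar k θ) * circleChar m θ)
    (fun k _ => ‖b k‖)
    (fun k => (continuous_const.mul (continuous_circleChar _)).aestronglyMeasurable)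
    (fun k => .of_forall fun θ _ => by simp [norm_circleChar])
    (.of_forall fun θ _ => hb) (by simp)
    (.of_forall fun θ _ => by
      have h : Summable fun k : ℕ => b k * circleChar k θ :=
        Summable.of_norm (by simpa [norm_circleChar] using hb)
      simpa only [circleChar_add, mul_assoc] using h.hasSum.mul_right (circleChar m θ))
  rw [← key.tsum_eq]
  simp only [intervalIntegral.integral_const_mul, integral_circleChar]

/-- Parseval's identity for trigonometric polynomials. -/
lemma integral_norm_sq_sum_circleChar (s : Finset ℕ) (c : ℕ → ℂ) :
    ∫ θ in (0 : ℝ)..2 * Real.pi, ‖∑ j ∈ s, c j * circleChar (-j) θ‖ ^ 2 =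
      2 * Real.pi * ∑ j ∈ s, ‖c j‖ ^ 2 := by
  apply Complex.ofReal_injective
  rw [← intervalIntegral.integral_ofReal]
  have h : ∀ θ : ℝ, ((‖∑ j ∈ s, c j * circleChar (-j) θ‖ ^ 2 : ℝ) : ℂ) =
      ∑ i ∈ s, ∑ j ∈ s, (c i * (starRingEnd ℂ) (c j)) * circleChar (-i + j) θ := by
    intro θ
    push_cast
    rw [← Complex.mul_conj', map_sum, Finset.sum_mul_sum]
    refine Finset.sum_congr rfl fun i _ => Finset.sum_congr rfl fun j _ => ?_
    rw [map_mul, conj_circleChar, circleChar_add, neg_neg]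
    ring
  simp only [h]
  rw [intervalIntegral.integral_finsetSum]
  swap
  · exact fun i _ => Continuous.intervalIntegrable (by fun_prop) _ _
  push_cast
  rw [Finset.mul_sum]
  refine Finset.sum_congr rfl fun i hi => ?_
  rw [intervalIntegral.integral_finsetSum]
  swap
  · exact fun j _ => Continuous.intervalIntegrable (by fun_prop) _ _
  simp only [intervalIntegral.integral_const_mul, integral_circleChar]
  rw [Finset.sum_eq_single i]
  · simp [Complex.mul_conj']; ring
  · intro j _ hj
    rw [if_neg (by omega), mul_zero]
  · exact fun h => absurd hi h

/-- Coefficient inequality for absolutely convergent power series bounded by one on the circle. -/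
lemma norm_coeff_add_sum_sq_le_one_of_summable {b : ℕ → ℂ} (hb : Summable fun n => ‖b n‖)
    (h1 : ∀ θ : ℝ, ‖∑' k : ℕ, b k * circleChar k θ‖ ≤ 1) {m n : ℕ} (hmn : 2 * m ≤ n + 1) :
    ‖b n‖ + ∑ j ∈ Finset.range m, ‖b j‖ ^ 2 ≤ 1 := by
  rcases Nat.lt_or_ge n m with h | hm
  · have hn : n = 0 ∧ m = 1 := by omega
    omega
  obtain ⟨u, hu, hub⟩ : ∃ u : ℂ, ‖u‖ = 1 ∧ u * b n = ‖b n‖ := by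
    by_cases h0 : b n = 0
    · exact ⟨1, by simp, by simp [h0]⟩
    · have h0' : (‖b n‖ : ℂ) ≠ 0 := by simpa using h0
      refine ⟨(starRingEnd ℂ) (b n) / ‖b n‖, by simp [h0], ?_⟩
      field_simp
      rw [mul_comm, Complex.mul_conj']
  set F : ℝ → ℂ := fun θ => ∑' k : ℕ, b k * circleChar k θ with hF
  have hFc : Continuous F := by
    refine continuous_tsum (fun k => continuous_const.mul (continuous_circleChar _)) hb ?_
    intro k θ
    simp [norm_circleChar]
  have hint (m : ℤ) : IntervalIntegrable (fun θ => F θ * circleChar m θ) MeasureTheory.volume 0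
      (2 * Real.pi) := (hFc.mul (continuous_circleChar m)).intervalIntegrable _ _
  have hcoef (k : ℕ) : ∫ θ in (0 : ℝ)..2 * Real.pi, F θ * circleChar (-k) θ =
      2 * Real.pi * b k := by
    rw [integral_tsum_mul_circleChar hb, tsum_eq_single k]
    · simp; ring
    · intro j hj
      rw [if_neg (by omega), mul_zero]
  have hcoef0 (m : ℤ) (hm : 0 < m) :
      ∫ θ in (0 : ℝ)..2 * Real.pi, F θ * circleChar m θ = 0 := by
    rw [integral_tsum_mul_circleChar hb]
    convert tsum_zero with k
    rw [if_neg (by omega), mul_zero]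
  set S := ∑ j ∈ Finset.range m, ‖b j‖ ^ 2 with hS
  have hnm : n ∉ Finset.range m := by simpa using hm
  set c : ℕ → ℂ := fun j => if j = n then u else (starRingEnd ℂ) (b j) with hc
  have hcn : c n = u := by simp [hc]
  have hcj : ∀ j ∈ Finset.range m, c j = (starRingEnd ℂ) (b j) := by
    intro j hj
    have : j ≠ n := by rintro rfl; exact hnm hj
    simp [hc, this]
  set P : ℝ → ℂ := fun θ => ∑ j ∈ insert n (Finset.range m), c j * circleChar (-j) θ with hP
  have hPc : Continuous P :=
    continuous_finsetSum _ fun j _ => continuous_const.mul (continuous_circleChar _)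
  have hPars : ∫ θ in (0 : ℝ)..2 * Real.pi, ‖P θ‖ ^ 2 = 2 * Real.pi * (1 + S) := by
    rw [integral_norm_sq_sum_circleChar, Finset.sum_insert hnm, hcn, hu, one_pow]
    congr 2
    refine Finset.sum_congr rfl fun j hj => ?_
    rw [hcj j hj, RCLike.norm_conj]
  have hexp (θ : ℝ) : F θ * (P θ ^ 2 * circleChar n θ) =
      ∑ i ∈ insert n (Finset.range m), ∑ j ∈ insert n (Finset.range m),
        (c i * c j) * (F θ * circleChar (n - i - j) θ) := by
    rw [hP]
    simp only [sq, Finset.sum_mul, Finset.mul_sum]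
    refine Finset.sum_congr rfl fun i _ => Finset.sum_congr rfl fun j _ => ?_
    rw [sub_eq_add_neg, sub_eq_add_neg, circleChar_add, circleChar_add]
    ring
  have hval : ∫ θ in (0 : ℝ)..2 * Real.pi, F θ * (P θ ^ 2 * circleChar n θ) =
      2 * Real.pi * (u * (‖b n‖ + 2 * S : ℝ)) := by
    simp only [hexp]
    rw [intervalIntegral.integral_finsetSum]
    swap
    · exact fun i _ => Continuous.intervalIntegrable (by fun_prop) _ _
    have h2 (i : ℕ) : ∫ θ in (0 : ℝ)..2 * Real.pi, (∑ j ∈ insert n (Finset.range m),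
        (c i * c j) * (F θ * circleChar (n - i - j) θ)) =
        ∑ j ∈ insert n (Finset.range m), (c i * c j) *
          ∫ θ in (0 : ℝ)..2 * Real.pi, F θ * circleChar (n - i - j) θ := by
      rw [intervalIntegral.integral_finsetSum fun j _ => (hint _).const_mul _]
      simp only [intervalIntegral.integral_const_mul]
    have hcb : ∀ j ∈ Finset.range m, c j * (2 * Real.pi * b j) =
        2 * Real.pi * ((‖b j‖ ^ 2 : ℝ) : ℂ) := by
      intro j hj
      rw [hcj j hj]
      push_cast
      rw [← Complex.mul_conj']
      ring
    have hrow : ∑ j ∈ Finset.range m, c j * (2 * Real.pi * b j) = 2 * Real.pi * (S : ℂ) := by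
      rw [Finset.sum_congr rfl hcb, ← Finset.mul_sum, hS]
      push_cast
      rfl
    simp only [h2]
    rw [Finset.sum_insert hnm, Finset.sum_insert hnm, hcn]
    have e1 : ((n : ℤ) - n - n) = -(n : ℤ) := by ring
    have e2 (j : ℕ) : ((n : ℤ) - n - j) = -(j : ℤ) := by ring
    have e3 (j : ℕ) : ((n : ℤ) - j - n) = -(j : ℤ) := by ring
    have h3 : ∀ i ∈ Finset.range m, ∑ j ∈ insert n (Finset.range m), (c i * c j) *
          ∫ θ in (0 : ℝ)..2 * Real.pi, F θ * circleChar (n - i - j) θ =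
        u * (c i * (2 * Real.pi * b i)) := by
      intro i hi
      rw [Finset.sum_insert hnm, e3, hcoef, hcn, Finset.sum_eq_zero]
      · ring
      · intro j hj
        rw [hcoef0, mul_zero]
        rw [Finset.mem_range] at hi hj
        omega
    rw [Finset.sum_congr rfl h3, ← Finset.mul_sum, hrow, e1, hcoef]
    simp only [e2, hcoef, mul_assoc]
    rw [← Finset.mul_sum]
    simp only [mul_assoc] at hrow
    rw [hrow]
    push_cast
    rw [← hub]
    ring
  have hle : ‖∫ θ in (0 : ℝ)..2 * Real.pi, F θ * (P θ ^ 2 * circleChar n θ)‖ ≤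
      ∫ θ in (0 : ℝ)..2 * Real.pi, ‖P θ‖ ^ 2 := by
    refine intervalIntegral.norm_integral_le_of_norm_le Real.two_pi_pos.le
      (.of_forall fun θ _ => ?_) ((hPc.norm.pow 2).intervalIntegrable _ _)
    rw [norm_mul, norm_mul, norm_pow, norm_circleChar, mul_one]
    exact mul_le_of_le_one_left (by positivity) (h1 θ)
  have hSnn : 0 ≤ S := by positivity
  have hnorm : ‖(2 * Real.pi * (u * (‖b n‖ + 2 * S : ℝ)) : ℂ)‖ =
      2 * Real.pi * (‖b n‖ + 2 * S) := by
    rw [norm_mul, norm_mul, norm_mul, hu, one_mul, Complex.norm_real, Complex.norm_real,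
      Complex.norm_two, Real.norm_of_nonneg Real.pi_pos.le, Real.norm_of_nonneg (by positivity)]
  rw [hPars, hval, hnorm] at hle
  have := le_of_mul_le_mul_left hle Real.two_pi_pos
  linarith

/-- Carlson-type coefficient inequality for analytic functions bounded by one on the unit disk. -/
lemma norm_coeff_add_sum_sq_le_one {f : ℂ → ℂ} {a : ℕ → ℂ}
    (hf : ∀ z : ℂ, ‖z‖ < 1 → HasSum (fun n : ℕ => a n * z ^ n) (f z))
    (hb : ∀ z : ℂ, ‖z‖ < 1 → ‖f z‖ ≤ 1) {m n : ℕ} (hmn : 2 * m ≤ n + 1) :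
    ‖a n‖ + ∑ j ∈ Finset.range m, ‖a j‖ ^ 2 ≤ 1 := by
  have key : ∀ ρ : ℝ, 0 < ρ → ρ < 1 →
      ‖a n‖ * ρ ^ n + ∑ j ∈ Finset.range m, (‖a j‖ * ρ ^ j) ^ 2 ≤ 1 := by
    intro ρ h0 h1
    have hn (k : ℕ) : ‖a k * (ρ : ℂ) ^ k‖ = ‖a k‖ * ρ ^ k := by
      rw [norm_mul, norm_pow, Complex.norm_real, Real.norm_of_nonneg h0.le]
    have hs : Summable fun k => ‖a k * (ρ : ℂ) ^ k‖ :=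
      (hf ρ (by rwa [Complex.norm_real, Real.norm_of_nonneg h0.le])).summable.norm
    have := norm_coeff_add_sum_sq_le_one_of_summable hs (fun θ => ?_) hmn
    · simpa only [hn] using this
    · have hz : ‖(ρ : ℂ) * circleChar 1 θ‖ < 1 := by
        rwa [norm_mul, norm_circleChar, mul_one, Complex.norm_real, Real.norm_of_nonneg h0.le]
      have h := (hf _ hz).tsum_eq
      simp only [mul_pow, ← circleChar_natCast, ← mul_assoc] at h
      rw [h]
      exact hb _ hz
  have hcont : Continuous fun ρ : ℝ =>
      ‖a n‖ * ρ ^ n + ∑ j ∈ Finset.range m, (‖a j‖ * ρ ^ j) ^ 2 := by fun_prop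
  have ht := (hcont.tendsto 1).mono_left (nhdsWithin_le_nhds (s := Set.Iio 1))
  simp only [one_pow, mul_one] at ht
  refine le_of_tendsto ht ?_
  filter_upwards [Ioo_mem_nhdsLT (show (0 : ℝ) < 1 by norm_num)] with ρ hρ
  exact key ρ hρ.1 hρ.2

/-- Theorem 1: If `f(z) = Σ aₙ zⁿ` is analytic in the unit disk and `|f| ≤ 1`, then for
`r ∈ [0,1)`, `Σ |aₙ| rⁿ ≤ (1/(1-r)) (1 - r Σ |aₙ|² r^{2n})`. -/
theorem stmt_0 (f : ℂ → ℂ) (a : ℕ → ℂ)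
    (hf : ∀ z : ℂ, ‖z‖ < 1 → HasSum (fun n : ℕ => a n * z ^ n) (f z))
    (hb : ∀ z : ℂ, ‖z‖ < 1 → ‖f z‖ ≤ 1)
    (r : ℝ) (hr0 : 0 ≤ r) (hr1 : r < 1) :
    ∑' n : ℕ, ‖a n‖ * r ^ n ≤
      (1 / (1 - r)) * (1 - r * ∑' n : ℕ, ‖a n‖ ^ 2 * r ^ (2 * n)) := by
  set T : ℕ → ℝ := fun n => ∑ j ∈ Finset.range ((n + 1) / 2), ‖a j‖ ^ 2 with hT
  have hT0 (n : ℕ) : 0 ≤ T n := by positivity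
  have hcoef (n : ℕ) : ‖a n‖ + T n ≤ 1 := norm_coeff_add_sum_sq_le_one hf hb (by omega)
  have hg : Summable fun n : ℕ => r ^ n := summable_geometric_of_lt_one hr0 hr1
  have hsT : Summable fun n => T n * r ^ n := by
    refine hg.of_nonneg_of_le (fun n => mul_nonneg (hT0 n) (by positivity)) fun n => ?_
    exact mul_le_of_le_one_left (by positivity) (by linarith [hcoef n, norm_nonneg (a n)])
  have hsa : Summable fun n => ‖a n‖ * r ^ n := by
    refine hg.of_nonneg_of_le (fun n => by positivity) fun n => ?_
    exact mul_le_of_le_one_left (by positivity) (by linarith [hcoef n, hT0 n])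
  have hsq : Summable fun n => ‖a n‖ ^ 2 * r ^ (2 * n) := by
    have hg2 : Summable fun n : ℕ => r ^ (2 * n) := by
      simpa only [pow_mul] using summable_geometric_of_lt_one (sq_nonneg r) (by nlinarith)
    refine hg2.of_nonneg_of_le (fun n => by positivity) fun n => ?_
    refine mul_le_of_le_one_left (by positivity) (pow_le_one₀ (norm_nonneg _) ?_)
    linarith [hcoef n, hT0 n]
  have hdiff : HasSum (fun n => (T (n + 1) - T n) * r ^ n)
      (∑' n : ℕ, ‖a n‖ ^ 2 * r ^ (2 * n)) := by
    rw [← add_zero (∑' n : ℕ, ‖a n‖ ^ 2 * r ^ (2 * n))]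
    refine HasSum.even_add_odd ?_ ?_
    · convert hsq.hasSum using 3 with k
      have e1 : (2 * k + 1 + 1) / 2 = k + 1 := by omega
      have e2 : (2 * k + 1) / 2 = k := by omega
      simp [hT, e1, e2, Finset.sum_range_succ]
    · convert hasSum_zero with k
      have e1 : (2 * k + 1 + 1 + 1) / 2 = k + 1 := by omega
      have e2 : (2 * k + 1 + 1) / 2 = k + 1 := by omega
      simp [hT, e1, e2]
  set V := ∑' n : ℕ, ‖a n‖ ^ 2 * r ^ (2 * n) with hV
  set U := ∑' n : ℕ, T n * r ^ n with hU
  have hshift : U = r * (V + U) := by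
    have h0 : T 0 = 0 := by simp [hT]
    have h1 := (hdiff.add hsT.hasSum).mul_left r
    rw [← h1.tsum_eq, hU, hsT.tsum_eq_zero_add, h0, zero_mul, zero_add]
    refine tsum_congr fun n => ?_
    ring
  have hle : ∑' n : ℕ, ‖a n‖ * r ^ n + U ≤ (1 - r)⁻¹ := by
    rw [← tsum_geometric_of_lt_one hr0 hr1, hU, ← hsa.tsum_add hsT]
    refine (hsa.add hsT).tsum_le_tsum (fun n => ?_) hg
    rw [← add_mul]
    exact mul_le_of_le_one_left (by positivity) (hcoef n)
  have h1r : 0 < 1 - r := by linarith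
  have hUV : U = r * V / (1 - r) := by
    rw [eq_div_iff h1r.ne']
    linarith
  calc _ ≤ (1 - r)⁻¹ - U := by linarith
    _ = _ := by rw [hUV]; field_simp
end

section
/- If f(z) = Σ_{n=0}^∞ a_n z^n is analytic in the open unit disk 𝔻 with |f(z)| ≤ 1 for all z ∈ 𝔻, then for every r ∈ [0,1) the majorant series satisfies Σ_{n=0}^∞ |a_n| r^n ≤ |a_0| + (r/(1-r))·(1 - |a_0|²) − (1/(1+|a_0|) + r/(1-r)) · Σ_{n=1}^∞ |a_n|² r^{2n}. -/
open ComplexConjugate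
open Finset.HasAntidiagonal (antidiagonal)

theorem integral_conj_circleMap_pow_mul (m n : ℕ) :
    ∫ θ in (0 : ℝ)..2 * Real.pi, conj (circleMap 0 1 θ) ^ m * circleMap 0 1 θ ^ n =
      if n = m then 2 * (Real.pi : ℂ) else 0 := by
  have h : ∀ θ : ℝ, conj (circleMap 0 1 θ) ^ m * circleMap 0 1 θ ^ n =
      Complex.exp ((((n : ℂ) - m) * Complex.I) * θ) := by
    intro θ
    simp only [circleMap, zero_add, Complex.ofReal_one, one_mul, ← Complex.exp_conj, map_mul,
      Complex.conj_ofReal, Complex.conj_I, ← Complex.exp_nat_mul, ← Complex.exp_add]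
    ring_nf
  simp only [h]
  split_ifs with hnm
  · simp [hnm]
  · have hc : ((n : ℂ) - m) ≠ 0 := sub_ne_zero.2 (by exact_mod_cast hnm)
    rw [integral_exp_mul_complex (mul_ne_zero hc Complex.I_ne_zero)]
    have : Complex.exp ((((n : ℂ) - m) * Complex.I) * ((2 * Real.pi : ℝ) : ℂ)) = 1 := by
      have := Complex.exp_int_mul_two_pi_mul_I ((n : ℤ) - m)
      push_cast at this ⊢
      rw [← this]; ring_nf
    rw [this]; simp

theorem summable_mul_circleMap_pow {d : ℕ → ℂ} (hd : Summable fun n => ‖d n‖) (θ : ℝ) :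
    Summable fun n => ‖d n * circleMap 0 1 θ ^ n‖ := by
  simpa using hd

theorem continuous_tsum_mul_circleMap_pow {d : ℕ → ℂ} (hd : Summable fun n => ‖d n‖) :
    Continuous fun θ : ℝ => ∑' n, d n * circleMap 0 1 θ ^ n :=
  continuous_tsum (fun n => by fun_prop) hd fun n θ => by simp

theorem integral_conj_circleMap_pow_mul_tsum {d : ℕ → ℂ} (hd : Summable fun n => ‖d n‖) (m : ℕ) :
    ∫ θ in (0 : ℝ)..2 * Real.pi, conj (circleMap 0 1 θ) ^ m * ∑' n, d n * circleMap 0 1 θ ^ n =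
      2 * Real.pi * d m := by
  have hF := intervalIntegral.hasSum_integral_of_dominated_convergence (μ := MeasureTheory.volume)
    (a := 0) (b := 2 * Real.pi)
    (F := fun (n : ℕ) (θ : ℝ) => d n * (conj (circleMap 0 1 θ) ^ m * circleMap 0 1 θ ^ n))
    (f := fun θ : ℝ => conj (circleMap 0 1 θ) ^ m * ∑' n, d n * circleMap 0 1 θ ^ n)
    (fun n _ => ‖d n‖)
    (fun n => (by fun_prop : Continuous fun θ : ℝ =>
      d n * (conj (circleMap 0 1 θ) ^ m * circleMap 0 1 θ ^ n)).aestronglyMeasurable)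
    (fun n => .of_forall fun θ _ => by simp)
    (.of_forall fun θ _ => hd)
    (by simp)
    (.of_forall fun θ _ => by
      have := (summable_mul_circleMap_pow hd θ).of_norm.hasSum.mul_left (conj (circleMap 0 1 θ) ^ m)
      simpa only [mul_left_comm] using this)
  simp only [intervalIntegral.integral_const_mul, integral_conj_circleMap_pow_mul, mul_ite,
    mul_zero] at hF
  rw [hF.unique (hasSum_single m fun n hn => if_neg hn)]
  simp [mul_comm]

theorem integral_conj_sum_mul_tsum {d : ℕ → ℂ} (hd : Summable fun n => ‖d n‖) (y : ℕ → ℂ) (N : ℕ) :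
    ∫ θ in (0 : ℝ)..2 * Real.pi, conj (∑ m ∈ Finset.range N, y m * circleMap 0 1 θ ^ m) *
        ∑' n, d n * circleMap 0 1 θ ^ n =
      2 * Real.pi * ∑ m ∈ Finset.range N, conj (y m) * d m := by
  have hc := continuous_tsum_mul_circleMap_pow hd
  simp only [map_sum, map_mul, map_pow, Finset.sum_mul, mul_assoc]
  rw [intervalIntegral.integral_finsetSum]
  · simp only [intervalIntegral.integral_const_mul, integral_conj_circleMap_pow_mul_tsum hd,
      Finset.mul_sum]
    exact Finset.sum_congr rfl fun m _ => by ring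
  · intro m _
    exact Continuous.intervalIntegrable (by fun_prop) _ _

theorem tsum_ite_lt_mul (y z : ℕ → ℂ) (N : ℕ) :
    ∑' n, (if n < N then y n else 0) * z n = ∑ n ∈ Finset.range N, y n * z n := by
  rw [tsum_eq_sum (s := Finset.range N)]
  · exact Finset.sum_congr rfl fun n hn => by rw [if_pos (Finset.mem_range.1 hn)]
  · intro n hn
    rw [if_neg (by simpa using hn), zero_mul]

theorem summable_norm_ite_lt (y : ℕ → ℂ) (N : ℕ) :
    Summable fun n => ‖if n < N then y n else 0‖ :=
  summable_of_ne_finset_zero (s := Finset.range N) fun n hn => by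
    rw [if_neg (by simpa using hn), norm_zero]

theorem integral_norm_sum_circleMap_sq (y : ℕ → ℂ) (N : ℕ) :
    ∫ θ in (0 : ℝ)..2 * Real.pi, ‖∑ m ∈ Finset.range N, y m * circleMap 0 1 θ ^ m‖ ^ 2 =
      2 * Real.pi * ∑ m ∈ Finset.range N, ‖y m‖ ^ 2 := by
  have h := integral_conj_sum_mul_tsum (summable_norm_ite_lt y N) y N
  simp only [tsum_ite_lt_mul, Complex.conj_mul'] at h
  rw [Finset.sum_congr rfl fun m hm => by
    rw [if_pos (Finset.mem_range.1 hm), Complex.conj_mul']] at h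
  simp only [← Complex.ofReal_pow] at h
  rw [intervalIntegral.integral_ofReal] at h
  exact_mod_cast h

/-- The lower triangular Toeplitz matrices of a function bounded by `1` on the unit circle are
contractions. -/
theorem re_sum_conj_mul_antidiagonal_le_of_summable {c : ℕ → ℂ} (hc : Summable fun n => ‖c n‖)
    (hb : ∀ u : ℂ, ‖u‖ = 1 → ‖∑' n, c n * u ^ n‖ ≤ 1) (x y : ℕ → ℂ) (N : ℕ) :
    (∑ m ∈ Finset.range N, conj (y m) * ∑ p ∈ antidiagonal m, c p.1 * x p.2).re ≤
      (∑ m ∈ Finset.range N, ‖x m‖ ^ 2 + ∑ m ∈ Finset.range N, ‖y m‖ ^ 2) / 2 := by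
  set x' : ℕ → ℂ := fun n => if n < N then x n else 0 with hx'
  have hxs : Summable fun n => ‖x' n‖ := summable_norm_ite_lt x N
  have hd := summable_norm_sum_mul_antidiagonal_of_summable_norm hc hxs
  have h := integral_conj_sum_mul_tsum hd y N
  have hsum : ∑ m ∈ Finset.range N, conj (y m) * ∑ p ∈ antidiagonal m, c p.1 * x' p.2 =
      ∑ m ∈ Finset.range N, conj (y m) * ∑ p ∈ antidiagonal m, c p.1 * x p.2 := by
    refine Finset.sum_congr rfl fun m hm => ?_
    congr 1
    refine Finset.sum_congr rfl fun p hp => ?_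
    have := Finset.HasAntidiagonal.mem_antidiagonal.1 hp
    have := Finset.mem_range.1 hm
    simp only [hx']
    rw [if_pos (by omega)]
  have hprod : ∀ θ : ℝ, ∑' n, (∑ p ∈ antidiagonal n, c p.1 * x' p.2) *
      circleMap 0 1 θ ^ n =
      (∑' n, c n * circleMap 0 1 θ ^ n) * ∑ n ∈ Finset.range N, x n * circleMap 0 1 θ ^ n := by
    intro θ
    rw [← tsum_ite_lt_mul, tsum_mul_tsum_eq_tsum_sum_antidiagonal_of_summable_norm
      (summable_mul_circleMap_pow hc θ) (summable_mul_circleMap_pow hxs θ)]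
    refine tsum_congr fun n => ?_
    rw [Finset.sum_mul]
    refine Finset.sum_congr rfl fun p hp => ?_
    rw [← Finset.HasAntidiagonal.mem_antidiagonal.1 hp, pow_add]
    ring
  rw [hsum] at h
  simp only [hprod] at h
  have hcont := continuous_tsum_mul_circleMap_pow hc
  have hre := congrArg Complex.re h
  rw [← Complex.reCLM_apply, ← ContinuousLinearMap.intervalIntegral_comp_comm _
    (Continuous.intervalIntegrable (by fun_prop) _ _)] at hre
  have hle : ∫ θ in (0 : ℝ)..2 * Real.pi,
      (conj (∑ m ∈ Finset.range N, y m * circleMap 0 1 θ ^ m) *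
        ((∑' n, c n * circleMap 0 1 θ ^ n) * ∑ n ∈ Finset.range N, x n * circleMap 0 1 θ ^ n)).re ≤
      ∫ θ in (0 : ℝ)..2 * Real.pi, (‖∑ m ∈ Finset.range N, x m * circleMap 0 1 θ ^ m‖ ^ 2 +
        ‖∑ m ∈ Finset.range N, y m * circleMap 0 1 θ ^ m‖ ^ 2) / 2 := by
    refine intervalIntegral.integral_mono_on (by positivity)
      (Continuous.intervalIntegrable (by fun_prop) _ _)
      (Continuous.intervalIntegrable (by fun_prop) _ _) fun θ _ => ?_
    refine (Complex.re_le_norm _).trans ?_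
    rw [norm_mul, norm_mul, RCLike.norm_conj]
    have h1 := hb (circleMap 0 1 θ) (by simp)
    set F := ‖∑' n, c n * circleMap 0 1 θ ^ n‖
    set X := ‖∑ m ∈ Finset.range N, x m * circleMap 0 1 θ ^ m‖
    set Y := ‖∑ m ∈ Finset.range N, y m * circleMap 0 1 θ ^ m‖
    have hX0 : 0 ≤ X := norm_nonneg _
    have hY0 : 0 ≤ Y := norm_nonneg _
    have : Y * (F * X) ≤ Y * X := by
      gcongr
      exact mul_le_of_le_one_left hX0 h1
    nlinarith [sq_nonneg (X - Y)]
  rw [intervalIntegral.integral_div, intervalIntegral.integral_add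
      (Continuous.intervalIntegrable (by fun_prop) _ _)
      (Continuous.intervalIntegrable (by fun_prop) _ _),
    integral_norm_sum_circleMap_sq, integral_norm_sum_circleMap_sq] at hle
  simp only [Complex.reCLM_apply] at hre
  rw [hre] at hle
  rw [show (2 * (Real.pi : ℂ)) = ((2 * Real.pi : ℝ) : ℂ) by push_cast; rfl,
    Complex.re_ofReal_mul] at hle
  have hpi : 0 < 2 * Real.pi := by positivity
  rw [← mul_add, mul_div_assoc] at hle
  exact le_of_mul_le_mul_left hle hpi

theorem re_sum_conj_mul_antidiagonal_le {f : ℂ → ℂ} {a : ℕ → ℂ}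
    (hf : ∀ z : ℂ, ‖z‖ < 1 → HasSum (fun n : ℕ => a n * z ^ n) (f z))
    (hb : ∀ z : ℂ, ‖z‖ < 1 → ‖f z‖ ≤ 1) (x y : ℕ → ℂ) (N : ℕ) :
    (∑ m ∈ Finset.range N, conj (y m) * ∑ p ∈ antidiagonal m, a p.1 * x p.2).re ≤
      (∑ m ∈ Finset.range N, ‖x m‖ ^ 2 + ∑ m ∈ Finset.range N, ‖y m‖ ^ 2) / 2 := by
  have hlim : Filter.Tendsto (fun ρ : ℝ => (∑ m ∈ Finset.range N, conj (y m) *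
      ∑ p ∈ antidiagonal m, (a p.1 * (ρ : ℂ) ^ p.1) * x p.2).re)
      (nhdsWithin 1 (Set.Iio 1))
      (nhds (∑ m ∈ Finset.range N, conj (y m) * ∑ p ∈ antidiagonal m, a p.1 * x p.2).re) := by
    have : Continuous fun ρ : ℝ => (∑ m ∈ Finset.range N, conj (y m) *
      ∑ p ∈ antidiagonal m, (a p.1 * (ρ : ℂ) ^ p.1) * x p.2).re := by fun_prop
    have h1 := (this.tendsto 1).mono_left (nhdsWithin_le_nhds (s := Set.Iio 1))
    simpa only [Complex.ofReal_one, one_pow, mul_one] using h1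
  refine le_of_tendsto hlim ?_
  filter_upwards [Ioo_mem_nhdsLT (zero_lt_one' ℝ)] with ρ hρ
  have hnorm : ∀ u : ℂ, ‖u‖ = 1 → ‖(ρ : ℂ) * u‖ < 1 := fun u hu => by
    simpa [hu, abs_of_pos hρ.1] using hρ.2
  refine re_sum_conj_mul_antidiagonal_le_of_summable
    (c := fun k => a k * (ρ : ℂ) ^ k) ?_ ?_ x y N
  · simpa using (hf ρ (by simpa using hnorm 1 (by simp))).summable.norm
  · intro u hu
    have := (hf _ (hnorm u hu)).tsum_eq
    simp only [mul_pow, ← mul_assoc] at this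
    rw [this]
    exact hb _ (hnorm u hu)

theorem exists_norm_one_conj_mul_eq_norm (z : ℂ) : ∃ ε : ℂ, ‖ε‖ = 1 ∧ conj ε * z = ‖z‖ := by
  by_cases hz : z = 0
  · exact ⟨1, by simp, by simp [hz]⟩
  · have hn : (‖z‖ : ℂ) ≠ 0 := by simpa using hz
    refine ⟨z / ‖z‖, by simp [hz], ?_⟩
    rw [map_div₀, Complex.conj_ofReal, div_mul_eq_mul_div, Complex.conj_mul', pow_two,
      mul_div_assoc, div_self hn, mul_one]

/-- The Carlson inequality for the coefficients of odd index. -/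
theorem norm_coeff_odd_le {f : ℂ → ℂ} {a : ℕ → ℂ}
    (hf : ∀ z : ℂ, ‖z‖ < 1 → HasSum (fun n : ℕ => a n * z ^ n) (f z))
    (hb : ∀ z : ℂ, ‖z‖ < 1 → ‖f z‖ ≤ 1) (n : ℕ) :
    ‖a (2 * n + 1)‖ ≤ 1 - ∑ k ∈ Finset.range (n + 1), ‖a k‖ ^ 2 := by
  obtain ⟨ε, hε, hεa⟩ := exists_norm_one_conj_mul_eq_norm (a (2 * n + 1))
  set x : ℕ → ℂ := fun j => if j = 0 then 1 else if n < j then ε * conj (a (2 * n + 1 - j)) else 0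
    with hx
  set y : ℕ → ℂ := fun m => if m ≤ n then a m else if m = 2 * n + 1 then ε else 0 with hy
  have hx0 : x 0 = 1 := by simp [hx]
  have hxmid : ∀ j, 0 < j → j ≤ n → x j = 0 := fun j h1 h2 => by
    simp only [hx]; rw [if_neg (by omega), if_neg (by omega)]
  have hxhi : ∀ k, k ≤ n → x (2 * n + 1 - k) = ε * conj (a k) := fun k hk => by
    simp only [hx]; rw [if_neg (by omega), if_pos (by omega)]; congr 3; omega
  have hylo : ∀ m, m ≤ n → y m = a m := fun m hm => by simp [hy, hm]
  have hymid : ∀ m, n < m → m < 2 * n + 1 → y m = 0 := fun m h1 h2 => by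
    simp only [hy]; rw [if_neg (by omega), if_neg (by omega)]
  have hytop : y (2 * n + 1) = ε := by
    simp only [hy]; simp only [if_true]; rw [if_neg (by omega)]
  have split : ∀ {M : Type} [AddCommMonoid M] (g : ℕ → M),
      (∀ k, n < k → k < 2 * n + 1 → g k = 0) →
      ∑ k ∈ Finset.range (2 * n + 1 + 1), g k = ∑ k ∈ Finset.range (n + 1), g k + g (2 * n + 1) := by
    intro M _ g hg
    rw [Finset.sum_range_succ, show 2 * n + 1 = n + 1 + n by ring, Finset.sum_range_add,
      Finset.sum_eq_zero (s := Finset.range n), add_zero]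
    intro i hi
    have := Finset.mem_range.1 hi
    exact hg _ (by omega) (by omega)
  have hconv : ∀ m, ∑ p ∈ antidiagonal m, a p.1 * x p.2 =
      ∑ k ∈ Finset.range (m + 1), a k * x (m - k) := fun m =>
    Finset.Nat.sum_antidiagonal_eq_sum_range_succ_mk _ _
  have hlow : ∀ m, m ≤ n → ∑ k ∈ Finset.range (m + 1), a k * x (m - k) = a m := by
    intro m hm
    rw [Finset.sum_range_succ, Nat.sub_self, hx0, mul_one, Finset.sum_eq_zero, zero_add]
    intro k hk
    have := Finset.mem_range.1 hk
    rw [hxmid _ (by omega) (by omega), mul_zero]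
  have htop : ∑ k ∈ Finset.range (2 * n + 1 + 1), a k * x (2 * n + 1 - k) =
      ε * ((∑ k ∈ Finset.range (n + 1), ‖a k‖ ^ 2 : ℝ) : ℂ) + a (2 * n + 1) := by
    rw [split, Nat.sub_self, hx0, mul_one, Complex.ofReal_sum, Finset.mul_sum]
    · congr 1
      refine Finset.sum_congr rfl fun k hk => ?_
      rw [hxhi k (by simpa [Nat.lt_succ_iff] using hk), mul_left_comm, Complex.mul_conj']
      push_cast; rfl
    · intro k h1 h2
      rw [hxmid _ (by omega) (by omega), mul_zero]
  have hxn : ∑ m ∈ Finset.range (2 * n + 1 + 1), ‖x m‖ ^ 2 =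
      ∑ k ∈ Finset.range (n + 1), ‖a k‖ ^ 2 + 1 := by
    rw [← Finset.sum_range_reflect]
    simp only [Nat.add_sub_cancel]
    rw [split, Nat.sub_self, hx0, norm_one, one_pow]
    · congr 1
      refine Finset.sum_congr rfl fun k hk => ?_
      rw [hxhi k (by simpa [Nat.lt_succ_iff] using hk), norm_mul, hε, one_mul, RCLike.norm_conj]
    · intro k h1 h2
      rw [hxmid _ (by omega) (by omega), norm_zero, zero_pow two_ne_zero]
  have hyn : ∑ m ∈ Finset.range (2 * n + 1 + 1), ‖y m‖ ^ 2 =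
      ∑ k ∈ Finset.range (n + 1), ‖a k‖ ^ 2 + 1 := by
    rw [split, hytop, hε, one_pow]
    · congr 1
      refine Finset.sum_congr rfl fun k hk => ?_
      rw [hylo k (by simpa [Nat.lt_succ_iff] using hk)]
    · intro k h1 h2
      rw [hymid k h1 h2, norm_zero, zero_pow two_ne_zero]
  have h := re_sum_conj_mul_antidiagonal_le hf hb x y (2 * n + 1 + 1)
  simp only [hconv] at h
  rw [hxn, hyn, split _ (fun k h1 h2 => by rw [hymid k h1 h2, map_zero, zero_mul]), htop, hytop,
    mul_add, ← mul_assoc, Complex.conj_mul', hε, hεa] at h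
  rw [Finset.sum_congr rfl fun m hm => by
    have hm' : m ≤ n := by simpa [Nat.lt_succ_iff] using hm
    rw [hlow m hm', hylo m hm', Complex.conj_mul']] at h
  set s := ∑ k ∈ Finset.range (n + 1), ‖a k‖ ^ 2 with hs
  have hsc : ∑ k ∈ Finset.range (n + 1), (‖a k‖ : ℂ) ^ 2 = (s : ℂ) := by rw [hs]; push_cast; rfl
  rw [hsc] at h
  simp at h
  linarith

theorem re_three_term_le {f : ℂ → ℂ} {a : ℕ → ℂ}
    (hf : ∀ z : ℂ, ‖z‖ < 1 → HasSum (fun n : ℕ => a n * z ^ n) (f z))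
    (hb : ∀ z : ℂ, ‖z‖ < 1 → ‖f z‖ ≤ 1) (q : ℕ) {ξ η ε : ℂ} (hε : ‖ε‖ = 1) :
    (conj η * (a 0 * ξ + a (q + 1)) + conj ε * (a (q + 1) * ξ + a (2 * q + 2))).re ≤
      1 - ∑ k ∈ Finset.range (q + 1), ‖a k‖ ^ 2 + (‖ξ‖ ^ 2 + ‖η‖ ^ 2) / 2 := by
  set x : ℕ → ℂ := fun j => if j = 0 then 1 else if j = q + 1 then ξ else
    if q + 1 < j then ε * conj (a (2 * q + 2 - j)) else 0 with hx
  set y : ℕ → ℂ := fun m => if m ≤ q then a m else if m = q + 1 then η else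
    if m = 2 * q + 2 then ε else 0 with hy
  have hx0 : x 0 = 1 := by simp [hx]
  have hxq : x (q + 1) = ξ := by simp [hx]
  have hxmid : ∀ j, 0 < j → j ≤ q → x j = 0 := fun j h1 h2 => by
    simp only [hx]; rw [if_neg (by omega), if_neg (by omega), if_neg (by omega)]
  have hxhi : ∀ k, k ≤ q → x (2 * q + 2 - k) = ε * conj (a k) := fun k hk => by
    simp only [hx]; rw [if_neg (by omega), if_neg (by omega), if_pos (by omega)]; congr 3; omega
  have hylo : ∀ m, m ≤ q → y m = a m := fun m hm => by simp [hy, hm]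
  have hyq : y (q + 1) = η := by simp [hy]
  have hymid : ∀ m, q + 1 < m → m < 2 * q + 2 → y m = 0 := fun m h1 h2 => by
    simp only [hy]; rw [if_neg (by omega), if_neg (by omega), if_neg (by omega)]
  have hytop : y (2 * q + 2) = ε := by
    simp only [hy]; simp only [if_true]; rw [if_neg (by omega), if_neg (by omega)]
  have split : ∀ {M : Type} [AddCommMonoid M] (g : ℕ → M),
      (∀ k, q + 1 < k → k < 2 * q + 2 → g k = 0) →
      ∑ k ∈ Finset.range (2 * q + 2 + 1), g k =
        ∑ k ∈ Finset.range (q + 1), g k + g (q + 1) + g (2 * q + 2) := by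
    intro M _ g hg
    rw [Finset.sum_range_succ, show 2 * q + 2 = q + 1 + 1 + q by ring, Finset.sum_range_add,
      Finset.sum_eq_zero (s := Finset.range q), add_zero, Finset.sum_range_succ]
    intro i hi
    have := Finset.mem_range.1 hi
    exact hg _ (by omega) (by omega)
  have hsub : 2 * q + 2 - (q + 1) = q + 1 := by omega
  have hconv : ∀ m, ∑ p ∈ antidiagonal m, a p.1 * x p.2 =
      ∑ k ∈ Finset.range (m + 1), a k * x (m - k) := fun m =>
    Finset.Nat.sum_antidiagonal_eq_sum_range_succ_mk _ _
  have hlow : ∀ m, m ≤ q → ∑ k ∈ Finset.range (m + 1), a k * x (m - k) = a m := by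
    intro m hm
    rw [Finset.sum_range_succ, Nat.sub_self, hx0, mul_one, Finset.sum_eq_zero, zero_add]
    intro k hk
    have := Finset.mem_range.1 hk
    rw [hxmid _ (by omega) (by omega), mul_zero]
  have hmid : ∑ k ∈ Finset.range (q + 1 + 1), a k * x (q + 1 - k) = a 0 * ξ + a (q + 1) := by
    rw [Finset.sum_range_succ, Nat.sub_self, hx0, mul_one, Finset.sum_range_succ', Nat.sub_zero,
      hxq, Finset.sum_eq_zero, zero_add]
    intro k hk
    have := Finset.mem_range.1 hk
    rw [hxmid _ (by omega) (by omega), mul_zero]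
  have htop : ∑ k ∈ Finset.range (2 * q + 2 + 1), a k * x (2 * q + 2 - k) =
      ε * ((∑ k ∈ Finset.range (q + 1), ‖a k‖ ^ 2 : ℝ) : ℂ) +
        (a (q + 1) * ξ + a (2 * q + 2)) := by
    rw [split, Nat.sub_self, hx0, mul_one, hsub, hxq, Complex.ofReal_sum, Finset.mul_sum, add_assoc]
    · congr 1
      refine Finset.sum_congr rfl fun k hk => ?_
      rw [hxhi k (by simpa [Nat.lt_succ_iff] using hk), mul_left_comm, Complex.mul_conj']
      push_cast; rfl
    · intro k h1 h2
      rw [hxmid _ (by omega) (by omega), mul_zero]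
  have hxn : ∑ m ∈ Finset.range (2 * q + 2 + 1), ‖x m‖ ^ 2 =
      ∑ k ∈ Finset.range (q + 1), ‖a k‖ ^ 2 + ‖ξ‖ ^ 2 + 1 := by
    rw [← Finset.sum_range_reflect]
    simp only [Nat.add_sub_cancel]
    rw [split, Nat.sub_self, hx0, norm_one, one_pow, hsub, hxq]
    · congr 2
      refine Finset.sum_congr rfl fun k hk => ?_
      rw [hxhi k (by simpa [Nat.lt_succ_iff] using hk), norm_mul, hε, one_mul, RCLike.norm_conj]
    · intro k h1 h2
      rw [hxmid _ (by omega) (by omega), norm_zero, zero_pow two_ne_zero]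
  have hyn : ∑ m ∈ Finset.range (2 * q + 2 + 1), ‖y m‖ ^ 2 =
      ∑ k ∈ Finset.range (q + 1), ‖a k‖ ^ 2 + ‖η‖ ^ 2 + 1 := by
    rw [split, hytop, hε, one_pow, hyq]
    · congr 2
      refine Finset.sum_congr rfl fun k hk => ?_
      rw [hylo k (by simpa [Nat.lt_succ_iff] using hk)]
    · intro k h1 h2
      rw [hymid k h1 h2, norm_zero, zero_pow two_ne_zero]
  have h := re_sum_conj_mul_antidiagonal_le hf hb x y (2 * q + 2 + 1)
  simp only [hconv] at h
  rw [hxn, hyn, split _ (fun k h1 h2 => by rw [hymid k h1 h2, map_zero, zero_mul]), htop, hytop,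
    hmid, hyq, mul_add (conj ε), ← mul_assoc (conj ε), Complex.conj_mul', hε] at h
  rw [Finset.sum_congr rfl fun m hm => by
    have hm' : m ≤ q := by simpa [Nat.lt_succ_iff] using hm
    rw [hlow m hm', hylo m hm', Complex.conj_mul']] at h
  set s := ∑ k ∈ Finset.range (q + 1), ‖a k‖ ^ 2 with hs
  have hsc : ∑ k ∈ Finset.range (q + 1), (‖a k‖ : ℂ) ^ 2 = (s : ℂ) := by rw [hs]; push_cast; rfl
  rw [hsc, Complex.ofReal_one, one_pow, one_mul] at h
  rw [Complex.add_re] at h ⊢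
  rw [Complex.add_re, Complex.add_re, Complex.ofReal_re] at h
  linarith

/-- The Carlson inequality for the coefficients of even index. -/
theorem norm_coeff_even_le {f : ℂ → ℂ} {a : ℕ → ℂ}
    (hf : ∀ z : ℂ, ‖z‖ < 1 → HasSum (fun n : ℕ => a n * z ^ n) (f z))
    (hb : ∀ z : ℂ, ‖z‖ < 1 → ‖f z‖ ≤ 1) (q : ℕ) :
    ‖a (2 * q + 2)‖ ≤
      1 - ∑ k ∈ Finset.range (q + 1), ‖a k‖ ^ 2 - ‖a (q + 1)‖ ^ 2 / (1 + ‖a 0‖) := by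
  obtain ⟨ε, hε, hεa⟩ := exists_norm_one_conj_mul_eq_norm (a (2 * q + 2))
  set b := a (q + 1)
  set t : ℝ := 1 / (1 + ‖a 0‖) with ht
  have htpos : 0 < 1 + ‖a 0‖ := by positivity
  have ht0 : 0 ≤ t := by positivity
  have h := re_three_term_le hf hb q (ξ := t * conj b * ε) (η := t * b) hε
  have hexp : conj ((t : ℂ) * b) * (a 0 * (t * conj b * ε) + b) +
      conj ε * (b * (t * conj b * ε) + a (2 * q + 2)) =
      ((2 * t * ‖b‖ ^ 2 + ‖a (2 * q + 2)‖ : ℝ) : ℂ) + t ^ 2 * (a 0 * conj b ^ 2 * ε) := by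
    have h1 : conj b * b = (‖b‖ : ℂ) ^ 2 := Complex.conj_mul' b
    have h2 : conj ε * ε = 1 := by rw [Complex.conj_mul', hε]; simp
    push_cast
    rw [map_mul, Complex.conj_ofReal, ← h1, ← hεa]
    linear_combination (t * conj b * b) * h2
  have hre : -(t ^ 2 * (‖a 0‖ * ‖b‖ ^ 2)) ≤ ((t : ℂ) ^ 2 * (a 0 * conj b ^ 2 * ε)).re := by
    have := (abs_le.1 (Complex.abs_re_le_norm ((t : ℂ) ^ 2 * (a 0 * conj b ^ 2 * ε)))).1
    simpa [hε, abs_of_nonneg ht0] using this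
  rw [hexp, Complex.add_re, Complex.ofReal_re] at h
  have hξ : ‖(t : ℂ) * conj b * ε‖ = t * ‖b‖ := by simp [hε, abs_of_nonneg ht0]
  have hη : ‖(t : ℂ) * b‖ = t * ‖b‖ := by simp [abs_of_nonneg ht0]
  rw [hξ, hη] at h
  have hkey : t ^ 2 * (1 + ‖a 0‖) = t := by rw [ht]; field_simp
  have hdiv : ‖b‖ ^ 2 / (1 + ‖a 0‖) = t * ‖b‖ ^ 2 := by rw [ht]; ring
  rw [hdiv]
  have : t ^ 2 * ‖b‖ ^ 2 + t ^ 2 * (‖a 0‖ * ‖b‖ ^ 2) = t * ‖b‖ ^ 2 := by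
    linear_combination ‖b‖ ^ 2 * hkey
  nlinarith

theorem sum_norm_coeff_mul_pow_le {b : ℕ → ℝ}
    (hodd : ∀ n, b (2 * n + 1) ≤ 1 - ∑ k ∈ Finset.range (n + 1), b k ^ 2)
    (heven : ∀ n, b (2 * n + 2) ≤
      1 - ∑ k ∈ Finset.range (n + 1), b k ^ 2 - b (n + 1) ^ 2 / (1 + b 0))
    {r : ℝ} (hr0 : 0 ≤ r) (hr1 : r < 1) (n : ℕ) :
    ∑ k ∈ Finset.range (2 * n + 2), b k * r ^ k ≤
      b 0 + r / (1 - r) * (1 - b 0 ^ 2) -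
        (1 / (1 + b 0) + r / (1 - r)) * ∑ k ∈ Finset.range n, b (k + 1) ^ 2 * r ^ (2 * (k + 1)) -
        r ^ (2 * n + 2) / (1 - r) * (1 - ∑ k ∈ Finset.range (n + 1), b k ^ 2) := by
  have hr : 1 - r ≠ 0 := by linarith
  induction n with
  | zero =>
    have h1 := hodd 0
    simp [Finset.sum_range_succ] at h1 ⊢
    have : b 1 * r ≤ (1 - b 0 ^ 2) * r := by gcongr
    have e : r / (1 - r) * (1 - b 0 ^ 2) - r ^ 2 / (1 - r) * (1 - b 0 ^ 2) =
      (1 - b 0 ^ 2) * r := by field_simp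
    linarith
  | succ n ih =>
    have h1 := hodd (n + 1)
    have h2 := heven n
    rw [show 2 * (n + 1) + 2 = 2 * n + 2 + 1 + 1 by ring, Finset.sum_range_succ,
      Finset.sum_range_succ _ (2 * n + 2), Finset.sum_range_succ _ n,
      Finset.sum_range_succ _ (n + 1)]
    rw [Finset.sum_range_succ _ (n + 1), show 2 * (n + 1) + 1 = 2 * n + 2 + 1 by ring] at h1
    rw [show 2 * (n + 1) = 2 * n + 2 by ring]
    set S := ∑ k ∈ Finset.range (n + 1), b k ^ 2
    set Q := ∑ k ∈ Finset.range n, b (k + 1) ^ 2 * r ^ (2 * (k + 1))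
    have g1 := mul_le_mul_of_nonneg_right h1 (pow_nonneg hr0 (2 * n + 2 + 1))
    have g2 := mul_le_mul_of_nonneg_right h2 (pow_nonneg hr0 (2 * n + 2))
    have e : r ^ (2 * n + 2) / (1 - r) * (1 - S) -
        (1 / (1 + b 0) + r / (1 - r)) * (b (n + 1) ^ 2 * r ^ (2 * n + 2)) -
        r ^ (2 * n + 2 + 1 + 1) / (1 - r) * (1 - (S + b (n + 1) ^ 2)) =
        (1 - S - b (n + 1) ^ 2 / (1 + b 0)) * r ^ (2 * n + 2) +
          (1 - (S + b (n + 1) ^ 2)) * r ^ (2 * n + 2 + 1) := by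
      rw [one_div, div_eq_mul_inv (b (n + 1) ^ 2)]
      generalize (1 + b 0)⁻¹ = c
      field_simp
      ring
    linarith


/-- If `f(z) = Σ aₙ zⁿ` is analytic in the unit disk with `|f| ≤ 1`, then for `r ∈ [0,1)`,
`Σ |aₙ| rⁿ ≤ |a₀| + (r/(1-r))(1-|a₀|²) - (1/(1+|a₀|) + r/(1-r)) Σ_{n≥1} |aₙ|² r^{2n}`. -/
theorem stmt_1 (f : ℂ → ℂ) (a : ℕ → ℂ)
    (hf : ∀ z : ℂ, ‖z‖ < 1 → HasSum (fun n : ℕ => a n * z ^ n) (f z))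
    (hb : ∀ z : ℂ, ‖z‖ < 1 → ‖f z‖ ≤ 1)
    (r : ℝ) (hr0 : 0 ≤ r) (hr1 : r < 1) :
    ∑' n : ℕ, ‖a n‖ * r ^ n ≤
      ‖a 0‖ + (r / (1 - r)) * (1 - ‖a 0‖ ^ 2) -
        (1 / (1 + ‖a 0‖) + r / (1 - r)) *
          ∑' n : ℕ, ‖a (n + 1)‖ ^ 2 * r ^ (2 * (n + 1)) := by
  have hodd := norm_coeff_odd_le hf hb
  have heven := norm_coeff_even_le hf hb
  have hsq : ∀ n, ‖a n‖ ^ 2 ≤ 1 := fun n => by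
    have := Finset.single_le_sum (f := fun k => ‖a k‖ ^ 2) (fun k _ => by positivity)
      (Finset.self_mem_range_succ n)
    have := hodd n
    have := norm_nonneg (a (2 * n + 1))
    linarith
  have hs1 : Summable fun n => ‖a n‖ * r ^ n := by
    have := (hf r (by simpa [abs_of_nonneg hr0] using hr1)).summable.norm
    simpa [abs_of_nonneg hr0] using this
  have hs2 : Summable fun n => ‖a (n + 1)‖ ^ 2 * r ^ (2 * (n + 1)) := by
    refine (summable_geometric_of_lt_one hr0 hr1).of_nonneg_of_le (fun n => by positivity)
      fun n => ?_
    calc ‖a (n + 1)‖ ^ 2 * r ^ (2 * (n + 1)) ≤ 1 * r ^ n :=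
          mul_le_mul (hsq _) (pow_le_pow_of_le_one hr0 hr1.le (by omega)) (by positivity) zero_le_one
      _ = r ^ n := one_mul _
  have hodd2 : Filter.Tendsto (fun n : ℕ => 2 * n + 2) Filter.atTop Filter.atTop :=
    Filter.tendsto_atTop_mono (fun n => by dsimp only [id]; omega) Filter.tendsto_id
  refine le_of_tendsto_of_tendsto' (hs1.hasSum.tendsto_sum_nat.comp hodd2)
    ((hs2.hasSum.tendsto_sum_nat.const_mul _).const_sub _) fun n => ?_
  refine (sum_norm_coeff_mul_pow_le (b := fun k => ‖a k‖) hodd heven hr0 hr1 n).trans ?_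
  refine sub_le_self _ (mul_nonneg (div_nonneg (pow_nonneg hr0 _) (by linarith)) ?_)
  exact (norm_nonneg _).trans (hodd n)
end

section
/- Fix a ∈ (0,1) and let φ_a(z) = (a−z)/(1−az), so that φ_a(z) = a − (1−a²) Σ_{k=1}^∞ a^{k−1} z^k with coefficients a_0 = a and a_n = −(1−a²)a^{n−1} for n ≥ 1. Then for every r ∈ (0,1), Σ_{n=0}^∞ |a_n| r^n + (1/(1+a) + r/(1−r)) · Σ_{n=1}^∞ |a_n|² r^{2n} = 1 + (1−a)·((2+a)r − 1)/(1−r). In particular, this quantity is strictly greater than 1 whenever r > 1/(2+a), showing that the radius 1/(2+|a_0|) in the refined Bohr inequality cannot be improved. -/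
/-- Sharpness of the radius `1/(2+|a₀|)`: for `φ_a(z) = (a-z)/(1-az)` with coefficients
`c 0 = a`, `c n = -(1-a²)a^{n-1}` for `n ≥ 1`, and any `r ∈ (0,1)`,
`Σ |cₙ| rⁿ + (1/(1+a)+r/(1-r)) Σ_{n≥1} |cₙ|² r^{2n} = 1 + (1-a)((2+a)r-1)/(1-r)`,
which exceeds `1` whenever `r > 1/(2+a)`. -/
theorem stmt_3 (a : ℝ) (ha0 : 0 < a) (ha1 : a < 1)
    (c : ℕ → ℝ) (hc0 : c 0 = a)
    (hc : ∀ n : ℕ, 1 ≤ n → c n = -(1 - a ^ 2) * a ^ (n - 1))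
    (r : ℝ) (hr0 : 0 < r) (hr1 : r < 1) :
    ((∑' n : ℕ, |c n| * r ^ n) +
        (1 / (1 + a) + r / (1 - r)) * ∑' n : ℕ, |c (n + 1)| ^ 2 * r ^ (2 * (n + 1)) =
      1 + (1 - a) * ((2 + a) * r - 1) / (1 - r)) ∧
    (1 / (2 + a) < r →
      1 < (∑' n : ℕ, |c n| * r ^ n) +
        (1 / (1 + a) + r / (1 - r)) * ∑' n : ℕ, |c (n + 1)| ^ 2 * r ^ (2 * (n + 1))) := by
  have hs : 0 < 1 - a ^ 2 := by nlinarith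
  have har : a * r < 1 := by nlinarith
  have har0 : 0 < a * r := mul_pos ha0 hr0
  have habs : ∀ n : ℕ, |c (n + 1)| = (1 - a ^ 2) * a ^ n := fun n => by
    rw [hc (n + 1) (by omega), Nat.add_sub_cancel, abs_mul, abs_neg, abs_of_pos hs,
      abs_of_pos (pow_pos ha0 n)]
  have hsum : HasSum (fun n : ℕ => |c (n + 1)| * r ^ (n + 1))
      ((1 - a ^ 2) * r * (1 - a * r)⁻¹) := by
    have hterm : (fun n : ℕ => |c (n + 1)| * r ^ (n + 1)) =
        fun n => (1 - a ^ 2) * r * (a * r) ^ n := by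
      funext n
      rw [habs, mul_pow]
      ring
    rw [hterm]
    exact (hasSum_geometric_of_lt_one har0.le har).mul_left _
  have hsum_sq : HasSum (fun n : ℕ => |c (n + 1)| ^ 2 * r ^ (2 * (n + 1)))
      (((1 - a ^ 2) * r) ^ 2 * (1 - (a * r) ^ 2)⁻¹) := by
    have hterm : (fun n : ℕ => |c (n + 1)| ^ 2 * r ^ (2 * (n + 1))) =
        fun n => ((1 - a ^ 2) * r) ^ 2 * ((a * r) ^ 2) ^ n := by
      funext n
      rw [habs, ← pow_mul, mul_pow a r]
      ring
    rw [hterm]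
    exact (hasSum_geometric_of_lt_one (sq_nonneg (a * r)) (by nlinarith)).mul_left _
  have hsum_all : ∑' n : ℕ, |c n| * r ^ n = a + (1 - a ^ 2) * r * (1 - a * r)⁻¹ := by
    have hsummable : Summable fun n : ℕ => |c n| * r ^ n :=
      (summable_nat_add_iff (f := fun n : ℕ => |c n| * r ^ n) 1).1 hsum.summable
    rw [hsummable.tsum_eq_zero_add, hsum.tsum_eq, hc0, abs_of_pos ha0, pow_zero, mul_one]
  have h1 : 1 - r ≠ 0 := (sub_pos.2 hr1).ne'
  have h2 : 1 - a * r ≠ 0 := (sub_pos.2 har).ne'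
  have h3 : 1 + a * r ≠ 0 := by positivity
  have h4 : 1 + a ≠ 0 := by positivity
  have hmain : (∑' n : ℕ, |c n| * r ^ n) +
        (1 / (1 + a) + r / (1 - r)) * ∑' n : ℕ, |c (n + 1)| ^ 2 * r ^ (2 * (n + 1)) =
      1 + (1 - a) * ((2 + a) * r - 1) / (1 - r) := by
    rw [hsum_all, hsum_sq.tsum_eq,
      show 1 - (a * r) ^ 2 = (1 - a * r) * (1 + a * r) by ring]
    field_simp
    ring
  refine ⟨hmain, fun h => ?_⟩
  rw [hmain]
  rw [div_lt_iff₀ (by linarith)] at h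
  have : 0 < (1 - a) * ((2 + a) * r - 1) / (1 - r) :=
    div_pos (mul_pos (by linarith) (by linarith)) (by linarith)
  linarith
end

section
/- Fix a ∈ (0,1) and let φ_a(z) = (a−z)/(1−az), with coefficients a_0 = a and a_n = −(1−a²)a^{n−1} for n ≥ 1. Then for every r ∈ (0,1), a² + Σ_{n=1}^∞ |a_n| r^n + (1/(1+a) + r/(1−r)) · Σ_{n=1}^∞ |a_n|² r^{2n} = 1 + (1−a²)(2r−1)/(1−r). In particular this quantity exceeds 1 whenever r > 1/2, showing the radius 1/2 in the second refined Bohr inequality is sharp. -/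
/-- Sharpness of the radius `1/2`: for `φ_a(z) = (a-z)/(1-az)` with coefficients
`c 0 = a`, `c n = -(1-a²)a^{n-1}` for `n ≥ 1`, and any `r ∈ (0,1)`,
`a² + Σ_{n≥1} |cₙ| rⁿ + (1/(1+a)+r/(1-r)) Σ_{n≥1} |cₙ|² r^{2n} = 1 + (1-a²)(2r-1)/(1-r)`,
which exceeds `1` whenever `r > 1/2`. -/
theorem stmt_5 (a : ℝ) (ha0 : 0 < a) (ha1 : a < 1)
    (c : ℕ → ℝ) (hc0 : c 0 = a)
    (hc : ∀ n : ℕ, 1 ≤ n → c n = -(1 - a ^ 2) * a ^ (n - 1))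
    (r : ℝ) (hr0 : 0 < r) (hr1 : r < 1) :
    (a ^ 2 + (∑' n : ℕ, |c (n + 1)| * r ^ (n + 1)) +
        (1 / (1 + a) + r / (1 - r)) * ∑' n : ℕ, |c (n + 1)| ^ 2 * r ^ (2 * (n + 1)) =
      1 + (1 - a ^ 2) * (2 * r - 1) / (1 - r)) ∧
    (1 / 2 < r →
      1 < a ^ 2 + (∑' n : ℕ, |c (n + 1)| * r ^ (n + 1)) +
        (1 / (1 + a) + r / (1 - r)) * ∑' n : ℕ, |c (n + 1)| ^ 2 * r ^ (2 * (n + 1))) := by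
  have ha2 : 0 < 1 - a ^ 2 := by nlinarith
  have har : a * r < 1 := by nlinarith
  have har0 : 0 < a * r := mul_pos ha0 hr0
  have habs (n : ℕ) : |c (n + 1)| = (1 - a ^ 2) * a ^ n := by
    rw [hc (n + 1) (Nat.le_add_left 1 n), Nat.add_sub_cancel, neg_mul, abs_neg,
      abs_of_nonneg (by positivity)]
  have hsum : ∑' n : ℕ, |c (n + 1)| * r ^ (n + 1) = (1 - a ^ 2) * r * (1 - a * r)⁻¹ := by
    rw [← tsum_geometric_of_lt_one har0.le har, ← tsum_mul_left]
    refine tsum_congr fun n => ?_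
    rw [habs]
    ring
  have hsum_sq : ∑' n : ℕ, |c (n + 1)| ^ 2 * r ^ (2 * (n + 1)) =
      (1 - a ^ 2) ^ 2 * r ^ 2 * (1 - (a * r) ^ 2)⁻¹ := by
    rw [← tsum_geometric_of_lt_one (sq_nonneg (a * r)) (by nlinarith), ← tsum_mul_left]
    refine tsum_congr fun n => ?_
    rw [habs]
    ring
  have heq : a ^ 2 + (∑' n : ℕ, |c (n + 1)| * r ^ (n + 1)) +
        (1 / (1 + a) + r / (1 - r)) * ∑' n : ℕ, |c (n + 1)| ^ 2 * r ^ (2 * (n + 1)) =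
      1 + (1 - a ^ 2) * (2 * r - 1) / (1 - r) := by
    have h1 : 1 - r ≠ 0 := by linarith
    have h2 : 1 - a * r ≠ 0 := by linarith
    have h3 : 1 + a * r ≠ 0 := by linarith
    have h4 : 1 + a ≠ 0 := by linarith
    rw [hsum, hsum_sq, show 1 - (a * r) ^ 2 = (1 - a * r) * (1 + a * r) by ring]
    field_simp
    ring
  refine ⟨heq, fun hr => ?_⟩
  rw [heq]
  exact lt_add_of_pos_right 1 (div_pos (mul_pos ha2 (by linarith)) (by linarith))
end

section
/- If f(z) = Σ_{n=1}^∞ a_n z^n is analytic in the open unit disk 𝔻 with f(0) = 0 and |f(z)| ≤ 1 for all z ∈ 𝔻, then for every r with 0 ≤ r ≤ 3/5 one has Σ_{n=1}^∞ |a_n| r^n + (1/(1+|a_1|) + r/(1−r)) · Σ_{n=2}^∞ |a_n|² r^{2n−1} ≤ 1. -/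
section

open Finset Filter Topology MeasureTheory ComplexConjugate

theorem norm_fourier_apply (n : ℤ) (t : UnitAddCircle) : ‖fourier n t‖ = 1 := by
  rw [fourier_apply, Circle.norm_coe]

theorem integral_fourier_haarAddCircle (n : ℤ) :
    ∫ t : UnitAddCircle, fourier n t ∂AddCircle.haarAddCircle = if n = 0 then 1 else 0 := by
  split_ifs with h
  · simp [h]
  · exact integral_eq_zero_of_add_right_eq_neg (fourier_add_half_inv_index h one_pos)

theorem integrable_haarAddCircle_of_continuous {E : Type*} [NormedAddCommGroup E]
    {g : UnitAddCircle → E} (hg : Continuous g) : Integrable g AddCircle.haarAddCircle :=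
  hg.integrable_of_hasCompactSupport (HasCompactSupport.of_compactSpace g)

theorem integral_tsum_mul_fourier {c : ℕ → ℂ} (hc : Summable fun k => ‖c k‖) (M s : ℕ) :
    ∫ t : UnitAddCircle, (∑' k : ℕ, c k * fourier (k : ℤ) t) * fourier ((s : ℤ) - M) t
      ∂AddCircle.haarAddCircle = if s ≤ M then c (M - s) else 0 := by
  have h := hasSum_integral_of_summable_integral_norm (μ := AddCircle.haarAddCircle)
    (F := fun (k : ℕ) (t : UnitAddCircle) => c k * fourier ((k : ℤ) + (s - M)) t)
    (fun k => integrable_haarAddCircle_of_continuous (by fun_prop))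
    (by simpa only [norm_mul, norm_fourier_apply, mul_one, integral_const, probReal_univ,
      one_smul] using hc)
  have h1 : ∀ t : UnitAddCircle, (∑' k : ℕ, c k * fourier (k : ℤ) t) * fourier ((s : ℤ) - M) t =
      ∑' k : ℕ, c k * fourier ((k : ℤ) + (s - M)) t := fun t => by
    rw [← tsum_mul_right]
    exact tsum_congr fun k => by rw [fourier_add, mul_assoc]
  simp_rw [h1, ← h.tsum_eq, integral_const_mul, integral_fourier_haarAddCircle]
  split_ifs with hs
  · rw [tsum_eq_single (M - s)]
    · rw [if_pos (by omega), mul_one]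
    · intro k hk
      rw [if_neg (by omega), mul_zero]
  · refine (tsum_congr fun k => ?_).trans tsum_zero
    rw [if_neg (by omega), mul_zero]

theorem integral_norm_sq_sum_fourier {ι : Type*} (S : Finset ι) {p : ι → ℕ}
    (hp : Set.InjOn p S) (w : ι → ℂ) :
    ∫ t : UnitAddCircle, ‖∑ i ∈ S, w i * fourier (p i : ℤ) t‖ ^ 2 ∂AddCircle.haarAddCircle =
      ∑ i ∈ S, ‖w i‖ ^ 2 := by
  have h1 : ∀ t : UnitAddCircle, ((‖∑ i ∈ S, w i * fourier (p i : ℤ) t‖ ^ 2 : ℝ) : ℂ) =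
      ∑ i ∈ S, ∑ j ∈ S, w i * conj (w j) * fourier ((p i : ℤ) + -(p j : ℤ)) t := fun t => by
    push_cast
    rw [← Complex.mul_conj', map_sum, sum_mul_sum]
    refine sum_congr rfl fun i _ => sum_congr rfl fun j _ => ?_
    rw [fourier_add, fourier_neg, map_mul]
    ring
  apply Complex.ofReal_injective
  rw [← integral_complex_ofReal]
  simp_rw [h1]
  rw [integral_finsetSum _ fun i _ => integrable_haarAddCircle_of_continuous (by fun_prop)]
  push_cast
  refine sum_congr rfl fun i hi => ?_
  rw [integral_finsetSum _ fun i _ => integrable_haarAddCircle_of_continuous (by fun_prop)]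
  simp_rw [integral_const_mul, integral_fourier_haarAddCircle]
  rw [sum_eq_single_of_mem i hi]
  · simp [Complex.mul_conj']
  · intro j hj hji
    have : p i ≠ p j := fun h => hji (hp hj hi h.symm)
    rw [if_neg (by omega), mul_zero]

/-- The coefficient of `z ^ M` in `f * R ^ 2`, where `R = ∑ w i * z ^ p i`, is at most the
squared `ℓ²` norm of the coefficients of `R` when `f` is bounded by one on the unit disk. -/
theorem norm_coeff_mul_sq_le {f : ℂ → ℂ} {a : ℕ → ℂ}
    (hf : ∀ z : ℂ, ‖z‖ < 1 → HasSum (fun n : ℕ => a n * z ^ n) (f z))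
    (hb : ∀ z : ℂ, ‖z‖ < 1 → ‖f z‖ ≤ 1) {ι : Type*} (S : Finset ι) {p : ι → ℕ}
    (hp : Set.InjOn p S) (w : ι → ℂ) (M : ℕ) :
    ‖∑ i ∈ S, ∑ j ∈ S, w i * w j * (if p i + p j ≤ M then a (M - (p i + p j)) else 0)‖ ≤
      ∑ i ∈ S, ‖w i‖ ^ 2 := by
  have hρ : ∀ ρ ∈ Set.Ioo (0 : ℝ) 1, ‖∑ i ∈ S, ∑ j ∈ S, w i * w j *
      (if p i + p j ≤ M then a (M - (p i + p j)) * (ρ : ℂ) ^ (M - (p i + p j)) else 0)‖ ≤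
      ∑ i ∈ S, ‖w i‖ ^ 2 := by
    rintro ρ ⟨hρ0, hρ1⟩
    have hz (t : UnitAddCircle) : ‖(ρ : ℂ) * fourier 1 t‖ < 1 := by
      rw [norm_mul, norm_fourier_apply, mul_one, Complex.norm_real, Real.norm_of_nonneg hρ0.le]
      exact hρ1
    have hc : Summable fun k => ‖a k * (ρ : ℂ) ^ k‖ := by
      have := (hf ρ (by rwa [Complex.norm_real, Real.norm_of_nonneg hρ0.le])).summable
      exact this.norm
    set g : UnitAddCircle → ℂ := fun t => ∑' k : ℕ, a k * (ρ : ℂ) ^ k * fourier (k : ℤ) t with hg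
    have hgf (t : UnitAddCircle) : g t = f (ρ * fourier 1 t) := by
      rw [← (hf _ (hz t)).tsum_eq]
      refine tsum_congr fun k => ?_
      rw [mul_pow, mul_assoc, fourier_one, fourier_apply, natCast_zsmul, AddCircle.toCircle_nsmul,
        Circle.coe_pow]
    have hgb (t : UnitAddCircle) : ‖g t‖ ≤ 1 := by
      rw [hgf]
      exact hb _ (hz t)
    have hgc : Continuous g := continuous_tsum (fun k => by fun_prop) hc fun k t => by
      rw [norm_mul _ (fourier _ t), norm_fourier_apply, mul_one]
    have hint : ∫ t : UnitAddCircle, g t * (∑ i ∈ S, w i * fourier (p i : ℤ) t) ^ 2 *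
        fourier (-(M : ℤ)) t ∂AddCircle.haarAddCircle = ∑ i ∈ S, ∑ j ∈ S, w i * w j *
        (if p i + p j ≤ M then a (M - (p i + p j)) * (ρ : ℂ) ^ (M - (p i + p j)) else 0) := by
      have h1 (t : UnitAddCircle) : g t * (∑ i ∈ S, w i * fourier (p i : ℤ) t) ^ 2 *
          fourier (-(M : ℤ)) t = ∑ i ∈ S, ∑ j ∈ S, w i * w j *
            (g t * fourier (((p i + p j : ℕ) : ℤ) - M) t) := by
        rw [sq, sum_mul_sum, mul_sum, sum_mul]
        refine sum_congr rfl fun i _ => ?_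
        rw [mul_sum, sum_mul]
        refine sum_congr rfl fun j _ => ?_
        rw [sub_eq_add_neg, fourier_add, Nat.cast_add, fourier_add]
        ring
      simp_rw [h1]
      rw [integral_finsetSum _ fun i _ => integrable_haarAddCircle_of_continuous (by fun_prop)]
      refine sum_congr rfl fun i _ => ?_
      rw [integral_finsetSum _ fun i _ => integrable_haarAddCircle_of_continuous (by fun_prop)]
      refine sum_congr rfl fun j _ => ?_
      rw [integral_const_mul, hg, integral_tsum_mul_fourier hc]
    rw [← hint, ← integral_norm_sq_sum_fourier S hp w]
    refine norm_integral_le_of_norm_le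
      (integrable_haarAddCircle_of_continuous (by fun_prop)) (.of_forall fun t => ?_)
    rw [norm_mul, norm_mul, norm_fourier_apply, mul_one, norm_pow]
    exact mul_le_of_le_one_left (by positivity) (hgb t)
  have hcont : Continuous fun ρ : ℝ => ‖∑ i ∈ S, ∑ j ∈ S, w i * w j *
      (if p i + p j ≤ M then a (M - (p i + p j)) * (ρ : ℂ) ^ (M - (p i + p j)) else 0)‖ := by
    refine (continuous_finsetSum _ fun i _ => continuous_finsetSum _ fun j _ => ?_).norm
    split_ifs <;> fun_prop
  have h1 := hcont.continuousWithinAt (s := Set.Iio 1) (x := 1)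
  have := le_of_tendsto h1 (by
    filter_upwards [Ioo_mem_nhdsLT (zero_lt_one' ℝ)] using hρ)
  simpa using this

theorem norm_toeplitz_form_le {f : ℂ → ℂ} {a : ℕ → ℂ} (h0 : a 0 = 0)
    (hf : ∀ z : ℂ, ‖z‖ < 1 → HasSum (fun n : ℕ => a n * z ^ n) (f z))
    (hb : ∀ z : ℂ, ‖z‖ < 1 → ‖f z‖ ≤ 1) {m N : ℕ} (hm : m ≤ N) (v : ℕ → ℂ) {η : ℂ}
    (hη : ‖η‖ = 1) :
    ‖η ^ 2 * a (N + 1) + 2 * η * ∑ k ∈ range m, v k * a (k + 1) +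
      ∑ k ∈ range m, ∑ l ∈ range m,
        v k * v l * (if N ≤ k + l then a (k + l - N + 1) else 0)‖ ≤
      1 + ∑ k ∈ range m, ‖v k‖ ^ 2 := by
  have h := norm_coeff_mul_sq_le hf hb (range (m + 1))
    (p := fun j => if j = 0 then 0 else N + 1 - j)
    (by
      intro i hi j hj hij
      simp only [coe_range, Set.mem_Iio] at hi hj
      dsimp only at hij
      split_ifs at hij <;> omega)
    (fun j => if j = 0 then η else v (j - 1)) (N + 1)
  simp only [sum_range_succ', Nat.add_eq_zero_iff, one_ne_zero, and_false, if_false, if_true,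
    Nat.add_sub_cancel, hη, Nat.add_sub_add_right, add_zero, zero_add, Nat.sub_zero, one_pow,
    Nat.zero_le] at h
  have e1 : ∀ k ∈ range m, (if N - k ≤ N + 1 then a (N + 1 - (N - k)) else 0) = a (k + 1) := by
    intro k hk
    rw [mem_range] at hk
    rw [if_pos (by omega)]
    congr 1
    omega
  have e2 : ∀ k ∈ range m, ∀ l ∈ range m,
      (if N - k + (N - l) ≤ N + 1 then a (N + 1 - (N - k + (N - l))) else 0) =
        if N ≤ k + l then a (k + l - N + 1) else 0 := by
    intro k hk l hl
    rw [mem_range] at hk hl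
    split_ifs
    · congr 1
      omega
    · rw [show N + 1 - (N - k + (N - l)) = 0 by omega, h0]
    · omega
    · rfl
  rw [sum_add_distrib,
    sum_congr rfl fun k hk => sum_congr rfl fun l hl => by rw [e2 k hk l hl],
    sum_congr (f := fun k => v k * η * _) rfl fun k hk => by rw [e1 k hk]] at h
  simp only [mul_comm _ η, mul_assoc η, ← mul_sum] at h
  rw [sum_congr (f := fun k => v k * ite _ _ _) rfl fun k hk => by rw [e1 k hk]] at h
  rw [add_comm (1 : ℝ)]
  refine le_of_eq_of_le ?_ h
  congr 1
  ring

theorem exists_norm_eq_one_mul_eq_norm (z : ℂ) : ∃ η : ℂ, ‖η‖ = 1 ∧ η * z = ‖z‖ := by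
  by_cases hz : z = 0
  · exact ⟨1, by simp [hz]⟩
  · have hz' : (‖z‖ : ℂ) ≠ 0 := by simpa using hz
    refine ⟨conj z / ‖z‖, by simp [hz], ?_⟩
    rw [div_mul_eq_mul_div, Complex.conj_mul', sq, mul_div_cancel_right₀ _ hz']

theorem carlson_odd {f : ℂ → ℂ} {a : ℕ → ℂ} (h0 : a 0 = 0)
    (hf : ∀ z : ℂ, ‖z‖ < 1 → HasSum (fun n : ℕ => a n * z ^ n) (f z))
    (hb : ∀ z : ℂ, ‖z‖ < 1 → ‖f z‖ ≤ 1) (n : ℕ) :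
    ‖a (2 * n + 1 + 1)‖ + ∑ k ∈ range (n + 1), ‖a (k + 1)‖ ^ 2 ≤ 1 := by
  obtain ⟨η, hη, hηa⟩ := exists_norm_eq_one_mul_eq_norm (a (2 * n + 1 + 1))
  have h := norm_toeplitz_form_le h0 hf hb (m := n + 1) (N := 2 * n + 1) (by omega)
    (fun k => conj (a (k + 1))) hη
  rw [sum_eq_zero (s := range (n + 1)) (f := fun k => ∑ l ∈ range (n + 1), _) fun k hk =>
    sum_eq_zero fun l hl => by
      rw [mem_range] at hk hl
      rw [if_neg (by omega), mul_zero]] at h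
  simp only [Complex.conj_mul', RCLike.norm_conj] at h
  rw [sq η, mul_assoc, hηa, add_zero, mul_comm 2 η, mul_assoc, ← mul_add, norm_mul, hη,
    one_mul] at h
  have h' := (Complex.re_le_norm _).trans h
  norm_cast at h'
  linarith

theorem carlson_even {f : ℂ → ℂ} {a : ℕ → ℂ} (h0 : a 0 = 0)
    (hf : ∀ z : ℂ, ‖z‖ < 1 → HasSum (fun n : ℕ => a n * z ^ n) (f z))
    (hb : ∀ z : ℂ, ‖z‖ < 1 → ‖f z‖ ≤ 1) (n : ℕ) :
    ‖a (2 * n + 2 + 1)‖ + ∑ k ∈ range (n + 1), ‖a (k + 1)‖ ^ 2 +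
      ‖a (n + 1 + 1)‖ ^ 2 / (1 + ‖a (0 + 1)‖) ≤ 1 := by
  obtain ⟨η, hη, hηa⟩ := exists_norm_eq_one_mul_eq_norm (a (2 * n + 2 + 1))
  set t : ℝ := 1 / (1 + ‖a (0 + 1)‖) with ht
  have htpos : 0 < 1 + ‖a (0 + 1)‖ := by positivity
  set v : ℕ → ℂ := fun k => if k = n + 1 then t * conj (a (k + 1)) else conj (a (k + 1)) with hv
  have hv1 : ∀ k ∈ range (n + 1), v k = conj (a (k + 1)) := fun k hk => by
    rw [mem_range] at hk
    simp only [hv]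
    rw [if_neg (by omega)]
  have hv2 : v (n + 1) = t * conj (a (n + 1 + 1)) := by simp [hv]
  have h := norm_toeplitz_form_le h0 hf hb (m := n + 1 + 1) (N := 2 * n + 2) (by omega) v hη
  have hd : ∑ k ∈ range (n + 1 + 1), ∑ l ∈ range (n + 1 + 1),
      v k * v l * (if 2 * n + 2 ≤ k + l then a (k + l - (2 * n + 2) + 1) else 0) =
      v (n + 1) * v (n + 1) * a (0 + 1) := by
    rw [sum_eq_single_of_mem (n + 1) (by simp), sum_eq_single_of_mem (n + 1) (by simp),
      if_pos (by omega), show n + 1 + (n + 1) - (2 * n + 2) = 0 by omega]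
    · intro l hl hl'
      rw [mem_range] at hl
      rw [if_neg (by omega), mul_zero]
    · intro k hk hk'
      refine sum_eq_zero fun l hl => ?_
      rw [mem_range] at hk hl
      rw [if_neg (by omega), mul_zero]
  rw [hd, sum_range_succ, sum_range_succ _ (n + 1),
    sum_congr rfl fun k hk => by rw [hv1 k hk, Complex.conj_mul'],
    sum_congr (g := fun k => ‖a (k + 1)‖ ^ 2) rfl fun k hk => by
      rw [hv1 k hk, RCLike.norm_conj], hv2, mul_assoc (t : ℂ), Complex.conj_mul'] at h
  set β := a (n + 1 + 1)
  set s := ∑ k ∈ range (n + 1), ‖a (k + 1)‖ ^ 2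
  have htn : ‖(t : ℂ) * conj β‖ = t * ‖β‖ := by
    rw [norm_mul, RCLike.norm_conj, Complex.norm_real, Real.norm_of_nonneg (by positivity)]
  rw [htn] at h
  have h3 : ‖(t : ℂ) * conj β * (t * conj β) * a (0 + 1)‖ = (t * ‖β‖) ^ 2 * ‖a (0 + 1)‖ := by
    rw [norm_mul, norm_mul, htn]
    ring
  have h2 : η ^ 2 * a (2 * n + 2 + 1) + 2 * η * (∑ k ∈ range (n + 1), (‖a (k + 1)‖ : ℂ) ^ 2 +
      t * (‖β‖ : ℂ) ^ 2) =
      η * ((‖a (2 * n + 2 + 1)‖ + 2 * (s + t * ‖β‖ ^ 2) : ℝ) : ℂ) := by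
    push_cast [s]
    rw [← hηa]
    ring
  have h4 := (norm_sub_le_norm_add _ _).trans h
  rw [h2, h3, norm_mul, hη, one_mul, Complex.norm_real] at h4
  have h5 := (Real.le_norm_self _).trans (sub_le_iff_le_add.1 h4)
  have ht1 : t * (1 + ‖a (0 + 1)‖) = 1 := one_div_mul_cancel htpos.ne'
  have h6 : (t * ‖β‖) ^ 2 * ‖a (0 + 1)‖ + (t * ‖β‖) ^ 2 = t * ‖β‖ ^ 2 := by
    linear_combination (t * ‖β‖ ^ 2) * ht1
  rw [div_eq_mul_one_div, ← ht]
  linarith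

theorem partial_sum_bound {B : ℕ → ℝ} (hB : ∀ k, 0 ≤ B k)
    (hodd : ∀ n, B (2 * n + 1) + ∑ k ∈ range (n + 1), B k ^ 2 ≤ 1)
    (heven : ∀ n, B (2 * n + 2) + ∑ k ∈ range (n + 1), B k ^ 2 + B (n + 1) ^ 2 / (1 + B 0) ≤ 1)
    {r : ℝ} (hr0 : 0 ≤ r) (hr1 : r < 1) (M : ℕ) :
    ∑ k ∈ range (2 * M), B (k + 1) * r ^ (k + 1) +
      (1 / (1 + B 0) + r / (1 - r)) * ∑ k ∈ range M, B (k + 1) ^ 2 * r ^ (2 * (k + 1)) ≤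
      (1 - B 0 ^ 2) * (r / (1 - r)) := by
  have h1r : 0 < 1 - r := by linarith
  have hstep : ∀ M : ℕ, ∑ k ∈ range (2 * M), B (k + 1) * r ^ (k + 1) +
      (1 / (1 + B 0) + r / (1 - r)) * ∑ k ∈ range M, B (k + 1) ^ 2 * r ^ (2 * (k + 1)) ≤
      (1 - B 0 ^ 2) * (r / (1 - r)) -
        (r / (1 - r)) * r ^ (2 * M) * (1 - ∑ k ∈ range (M + 1), B k ^ 2) := by
    intro M
    induction M with
    | zero => simp; linarith
    | succ M ih =>
      have e1 := mul_le_mul_of_nonneg_right (hodd M) (pow_nonneg hr0 (2 * M + 1))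
      have e2 := mul_le_mul_of_nonneg_right (heven M) (pow_nonneg hr0 (2 * M + 2))
      rw [show 2 * (M + 1) = 2 * M + 1 + 1 by ring, sum_range_succ, sum_range_succ,
        sum_range_succ (fun k => B (k + 1) ^ 2 * r ^ (2 * (k + 1))),
        sum_range_succ (fun k => B k ^ 2) (M + 1)]
      set S := ∑ k ∈ range (M + 1), B k ^ 2
      set D := r / (1 - r) with hD
      have hDr : D * (1 - r) = r := div_mul_cancel₀ _ h1r.ne'
      have key : D * r ^ (2 * M) * (1 - S) - D * r ^ (2 * M + 1 + 1) * (1 - S) =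
          (r ^ (2 * M + 1) + r ^ (2 * M + 2)) * (1 - S) := by
        linear_combination (r ^ (2 * M) * (1 + r) * (1 - S)) * hDr
      rw [div_eq_mul_one_div] at e2
      set w := 1 / (1 + B 0)
      rw [show 2 * (M + 1) = 2 * M + 2 by ring, show 2 * M + 1 + 1 = 2 * M + 2 by ring] at *
      linarith
  refine (hstep M).trans ?_
  have : 0 ≤ 1 - ∑ k ∈ range (M + 1), B k ^ 2 := by linarith [hodd M, hB (2 * M + 1)]
  have : 0 ≤ (r / (1 - r)) * r ^ (2 * M) * (1 - ∑ k ∈ range (M + 1), B k ^ 2) := by positivity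
  linarith

theorem bohr_bound {B : ℕ → ℝ} (hB : ∀ k, 0 ≤ B k)
    (hodd : ∀ n, B (2 * n + 1) + ∑ k ∈ range (n + 1), B k ^ 2 ≤ 1)
    (heven : ∀ n, B (2 * n + 2) + ∑ k ∈ range (n + 1), B k ^ 2 + B (n + 1) ^ 2 / (1 + B 0) ≤ 1)
    {r : ℝ} (hr0 : 0 ≤ r) (hr1 : r ≤ 3 / 5) :
    (∑' n, B n * r ^ (n + 1)) +
      (1 / (1 + B 0) + r / (1 - r)) * ∑' n, B (n + 1) ^ 2 * r ^ (2 * (n + 2) - 1) ≤ 1 := by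
  have h1r : 0 < 1 - r := by linarith
  have hsum_le : ∀ n, B n ^ 2 ≤ 1 := fun n => by
    have h := hodd n
    rw [sum_range_succ] at h
    have : 0 ≤ ∑ k ∈ range n, B k ^ 2 := sum_nonneg fun k _ => sq_nonneg _
    linarith [hB (2 * n + 1)]
  have hle : ∀ n, B n ≤ 1 := fun n => by nlinarith [hsum_le n, hB n]
  have hgeom : Summable fun n : ℕ => r ^ n := summable_geometric_of_lt_one hr0 (by linarith)
  have hs1 : Summable fun n => B (n + 1) * r ^ (n + 1) :=
    .of_nonneg_of_le (fun n => mul_nonneg (hB _) (pow_nonneg hr0 _))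
      (fun n => mul_le_of_le_one_left (pow_nonneg hr0 _) (hle _))
      ((summable_nat_add_iff 1).2 hgeom)
  have hs2 : Summable fun n => B (n + 1) ^ 2 * r ^ (2 * (n + 1)) :=
    .of_nonneg_of_le (fun n => mul_nonneg (sq_nonneg _) (pow_nonneg hr0 _))
      (fun n => (mul_le_of_le_one_left (pow_nonneg hr0 _) (hsum_le _)).trans
        (pow_le_pow_of_le_one hr0 (by linarith) (by omega : n ≤ 2 * (n + 1)))) hgeom
  have hlim := le_of_tendsto' ((hs1.hasSum.tendsto_sum_nat.comp
      (tendsto_id.const_mul_atTop' (two_pos : 0 < 2))).add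
      (hs2.hasSum.tendsto_sum_nat.const_mul (1 / (1 + B 0) + r / (1 - r))))
    (partial_sum_bound hB hodd heven hr0 (by linarith))
  have hs0 : Summable fun n => B n * r ^ n := (summable_nat_add_iff 1).1 hs1
  have t1 : ∑' n, B n * r ^ (n + 1) = r * (B 0 + ∑' n, B (n + 1) * r ^ (n + 1)) := by
    have := hs0.tsum_eq_zero_add
    rw [pow_zero, mul_one] at this
    rw [← this, ← tsum_mul_left]
    exact tsum_congr fun n => by ring
  have t2 : ∑' n, B (n + 1) ^ 2 * r ^ (2 * (n + 2) - 1) =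
      r * ∑' n, B (n + 1) ^ 2 * r ^ (2 * (n + 1)) := by
    rw [← tsum_mul_left]
    refine tsum_congr fun n => ?_
    rw [show 2 * (n + 2) - 1 = 2 * (n + 1) + 1 by omega]
    ring
  rw [t1, t2]
  have hD : r / (1 - r) ≤ 3 / 2 := by
    rw [div_le_iff₀ h1r]
    linarith
  have hc : 0 ≤ 1 - B 0 ^ 2 := by linarith [hsum_le 0]
  have hfin : B 0 + (1 - B 0 ^ 2) * (r / (1 - r)) ≤ 5 / 3 := by
    nlinarith [mul_le_mul_of_nonneg_left hD hc, sq_nonneg (B 0 - 1 / 3)]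
  have := mul_le_mul_of_nonneg_left ((add_le_add_right hlim (B 0)).trans hfin) hr0
  linarith

end

/-- Theorem 3(a): if `f(z) = Σ_{n≥1} aₙ zⁿ` is analytic in the unit disk with `f(0) = 0` and
`|f| ≤ 1`, then for `0 ≤ r ≤ 3/5`,
`Σ_{n≥1} |aₙ| rⁿ + (1/(1+|a₁|) + r/(1-r)) Σ_{n≥2} |aₙ|² r^{2n-1} ≤ 1`. -/
theorem stmt_6 (f : ℂ → ℂ) (a : ℕ → ℂ) (h0 : a 0 = 0)
    (hf : ∀ z : ℂ, ‖z‖ < 1 → HasSum (fun n : ℕ => a n * z ^ n) (f z))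
    (hb : ∀ z : ℂ, ‖z‖ < 1 → ‖f z‖ ≤ 1)
    (r : ℝ) (hr0 : 0 ≤ r) (hr1 : r ≤ 3 / 5) :
    (∑' n : ℕ, ‖a (n + 1)‖ * r ^ (n + 1)) +
      (1 / (1 + ‖a 1‖) + r / (1 - r)) *
        ∑' n : ℕ, ‖a (n + 2)‖ ^ 2 * r ^ (2 * (n + 2) - 1) ≤ 1 := by
  exact bohr_bound (B := fun k => ‖a (k + 1)‖) (fun k => norm_nonneg _)
    (carlson_odd h0 hf hb) (carlson_even h0 hf hb) hr0 hr1
end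

section
/- For every r with 3/5 < r < 1 there exists a ∈ (0,1) (namely a = (1−r)/(2r)) such that for the function f(z) = z(a−z)/(1−az), with coefficients a_1 = a and a_n = −(1−a²)a^{n−2} for n ≥ 2, one has Σ_{n=1}^∞ |a_n| r^n + (1/(1+a) + r/(1−r)) · Σ_{n=2}^∞ |a_n|² r^{2n−1} = (ar(1−r) + (1−a²)r²)/(1−r) > 1. Hence the radius 3/5 in part (a) of the theorem cannot be improved. -/
/-- The Bohr sum of `z(a-z)/(1-az)` at radius `r`. -/
theorem hasSum_abs_coeff_mul_pow {a r : ℝ} (ha0 : 0 ≤ a) (ha1 : a ≤ 1) (hr0 : 0 ≤ r)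
    (har : a * r < 1) {c : ℕ → ℝ} (hc1 : c 1 = a)
    (hc : ∀ n : ℕ, 2 ≤ n → c n = -(1 - a ^ 2) * a ^ (n - 2)) :
    HasSum (fun n : ℕ => |c (n + 1)| * r ^ (n + 1))
      (a * r + (1 - a ^ 2) * r ^ 2 * (1 - a * r)⁻¹) := by
  have ha2 : 0 ≤ 1 - a ^ 2 := by nlinarith
  have htail : HasSum (fun n : ℕ => |c (n + 1 + 1)| * r ^ (n + 1 + 1))
      ((1 - a ^ 2) * r ^ 2 * (1 - a * r)⁻¹) := by
    have hterm (n : ℕ) : |c (n + 1 + 1)| * r ^ (n + 1 + 1) =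
        (1 - a ^ 2) * r ^ 2 * (a * r) ^ n := by
      rw [hc (n + 1 + 1) (by lia), neg_mul, abs_neg, abs_of_nonneg (by positivity),
        show n + 1 + 1 - 2 = n by lia]
      ring
    simp only [hterm]
    exact (hasSum_geometric_of_lt_one (by positivity) har).mul_left _
  have h := HasSum.zero_add (f := fun n : ℕ => |c (n + 1)| * r ^ (n + 1)) htail
  rwa [zero_add, hc1, abs_of_nonneg ha0, pow_one] at h

/-- The weighted area sum of `z(a-z)/(1-az)` at radius `r`, without its linear term. -/
theorem hasSum_abs_coeff_sq_mul_pow {a r : ℝ} (ha0 : 0 ≤ a) (hr0 : 0 ≤ r)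
    (har : a * r < 1) {c : ℕ → ℝ}
    (hc : ∀ n : ℕ, 2 ≤ n → c n = -(1 - a ^ 2) * a ^ (n - 2)) :
    HasSum (fun n : ℕ => |c (n + 2)| ^ 2 * r ^ (2 * (n + 2) - 1))
      ((1 - a ^ 2) ^ 2 * r ^ 3 * (1 - (a * r) ^ 2)⁻¹) := by
  have har2 : (a * r) ^ 2 < 1 := pow_lt_one₀ (by positivity) har two_ne_zero
  have hterm (n : ℕ) : |c (n + 2)| ^ 2 * r ^ (2 * (n + 2) - 1) =
      (1 - a ^ 2) ^ 2 * r ^ 3 * ((a * r) ^ 2) ^ n := by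
    rw [hc (n + 2) (by lia), sq_abs, Nat.add_sub_cancel, show 2 * (n + 2) - 1 = 2 * n + 3 by lia]
    ring
  simp only [hterm]
  exact (hasSum_geometric_of_lt_one (by positivity) har2).mul_left _

/-- Sharpness of the radius `3/5` in Theorem 3(a): for every `r ∈ (3/5, 1)` there is
`a ∈ (0,1)` (namely `a = (1-r)/(2r)`) such that for `f(z) = z(a-z)/(1-az)`, with
coefficients `c 1 = a`, `c n = -(1-a²)a^{n-2}` for `n ≥ 2`, the quantity
`Σ_{n≥1} |cₙ| rⁿ + (1/(1+a) + r/(1-r)) Σ_{n≥2} |cₙ|² r^{2n-1}` equals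
`(ar(1-r) + (1-a²)r²)/(1-r)` and is greater than `1`. -/
theorem stmt_7 (r : ℝ) (hr : 3 / 5 < r) (hr1 : r < 1) :
    ∃ a : ℝ, 0 < a ∧ a < 1 ∧ a = (1 - r) / (2 * r) ∧
      ∀ c : ℕ → ℝ, c 1 = a → (∀ n : ℕ, 2 ≤ n → c n = -(1 - a ^ 2) * a ^ (n - 2)) →
        ((∑' n : ℕ, |c (n + 1)| * r ^ (n + 1)) +
            (1 / (1 + a) + r / (1 - r)) *
              ∑' n : ℕ, |c (n + 2)| ^ 2 * r ^ (2 * (n + 2) - 1) =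
          (a * r * (1 - r) + (1 - a ^ 2) * r ^ 2) / (1 - r)) ∧
        1 < (a * r * (1 - r) + (1 - a ^ 2) * r ^ 2) / (1 - r) := by
  have hr0 : 0 < r := by linarith
  have h1r : 0 < 1 - r := by linarith
  obtain ⟨a, ha⟩ : ∃ a : ℝ, a = (1 - r) / (2 * r) := ⟨_, rfl⟩
  have har : a * r = (1 - r) / 2 := by rw [ha]; field_simp
  have ha0 : 0 < a := by rw [ha]; positivity
  have ha1 : a < 1 := by rw [ha, div_lt_one (by positivity)]; linarith
  have har1 : a * r < 1 := by linarith
  refine ⟨a, ha0, ha1, ha, fun c hc1 hc => ⟨?_, ?_⟩⟩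
  · rw [(hasSum_abs_coeff_mul_pow ha0.le ha1.le hr0.le har1 hc1 hc).tsum_eq,
      (hasSum_abs_coeff_sq_mul_pow ha0.le hr0.le har1 hc).tsum_eq,
      show 1 - (a * r) ^ 2 = (1 - a * r) * (1 + a * r) by ring]
    have h1 : 1 - a * r ≠ 0 := (sub_pos.2 har1).ne'
    have h2 : 1 + a * r ≠ 0 := by positivity
    have h3 : 1 + a ≠ 0 := by positivity
    field_simp
    ring
  · rw [lt_div_iff₀ h1r, show (1 - a ^ 2) * r ^ 2 = r ^ 2 - (a * r) ^ 2 by ring, har]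
    nlinarith [mul_pos (sub_pos.2 hr) hr0]
end

section
/- For the function f(z) = z (so a_1 = 1 and a_n = 0 for n ≥ 2) and r ∈ (0,1), the quantity Σ_{n=1}^∞ |a_n| r^n + (r^{−1}/(1+|a_1|) + 1/(1−r)) · Σ_{n=1}^∞ |a_n|² r^{2n} equals (3r − r²)/(2(1 − r)), and this is ≤ 1 if and only if r ≤ (5−√17)/2. Hence the radius (5−√17)/2 in part (b) of the theorem is sharp. -/
/-- Sharpness of the radius `(5-√17)/2` in Theorem 3(b): for `f(z) = z` (coefficients
`c 1 = 1`, `c n = 0` for `n ≠ 1`) and `r ∈ (0,1)`, the quantity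
`Σ_{n≥1} |cₙ| rⁿ + (r⁻¹/(1+|c₁|) + 1/(1-r)) Σ_{n≥1} |cₙ|² r^{2n}` equals
`(3r - r²)/(2(1-r))`, which is `≤ 1` iff `r ≤ (5-√17)/2`. -/
theorem stmt_9 (c : ℕ → ℝ) (hc1 : c 1 = 1) (hc : ∀ n : ℕ, n ≠ 1 → c n = 0)
    (r : ℝ) (hr0 : 0 < r) (hr1 : r < 1) :
    ((∑' n : ℕ, |c (n + 1)| * r ^ (n + 1)) +
        (r⁻¹ / (1 + |c 1|) + 1 / (1 - r)) *
          ∑' n : ℕ, |c (n + 1)| ^ 2 * r ^ (2 * (n + 1)) =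
      (3 * r - r ^ 2) / (2 * (1 - r))) ∧
    ((3 * r - r ^ 2) / (2 * (1 - r)) ≤ 1 ↔ r ≤ (5 - Real.sqrt 17) / 2) := by
  have h_vanish : ∀ n : ℕ, n ≠ 0 → c (n + 1) = 0 := fun n hn => hc _ (by omega)
  have h_linear : ∑' n : ℕ, |c (n + 1)| * r ^ (n + 1) = r := by
    rw [tsum_eq_single 0 (fun n hn => by simp [h_vanish n hn])]
    simp [hc1]
  have h_square : ∑' n : ℕ, |c (n + 1)| ^ 2 * r ^ (2 * (n + 1)) = r ^ 2 := by
    rw [tsum_eq_single 0 (fun n hn => by simp [h_vanish n hn])]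
    simp [hc1]
  have h_pos : 0 < 1 - r := sub_pos.mpr hr1
  have h_sqrt : Real.sqrt 17 ^ 2 = 17 := Real.sq_sqrt (by norm_num)
  have h_sqrt_nonneg := Real.sqrt_nonneg 17
  refine ⟨?_, ?_⟩
  · rw [h_linear, h_square, hc1, abs_one]
    field_simp
    ring
  · rw [div_le_one (by positivity)]
    constructor
    · intro h
      have h_sq : Real.sqrt 17 ^ 2 ≤ (5 - 2 * r) ^ 2 := by nlinarith
      linarith [(sq_le_sq₀ h_sqrt_nonneg (by linarith)).mp h_sq]
    · intro h
      nlinarith [pow_le_pow_left₀ h_sqrt_nonneg (by linarith : Real.sqrt 17 ≤ 5 - 2 * r) 2]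
end

section
/- If f(z) = Σ_{n=1}^∞ a_n z^n is analytic in the open unit disk 𝔻 with f(0) = 0, |f(z)| ≤ 1 for all z ∈ 𝔻, and a = |a_1|, then for every r with 0 < r ≤ r(a) := 2(1+a)/(1 + 2a + 2a² + √(4a⁴ + 8a + 5)) one has Σ_{n=1}^∞ |a_n| r^n + (r^{−1}/(1+a) + 1/(1−r)) · Σ_{n=1}^∞ |a_n|² r^{2n} ≤ 1. -/
theorem Orthonormal.hasSum_sq_norm {ι E : Type*} [NormedAddCommGroup E] [InnerProductSpace ℂ E]
    {e : ι → E} (he : Orthonormal ℂ e) {c : ι → ℂ} {v : E} (hv : HasSum (fun i => c i • e i) v) :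
    HasSum (fun i => ‖c i‖ ^ 2) (‖v‖ ^ 2) := by
  classical
  have hcoeff (j : ι) : inner ℂ (e j) v = c j := by
    have h := hv.mapL (innerSL ℂ (e j))
    refine h.unique ((hasSum_ite_eq j (c j)).congr_fun fun i => ?_)
    simp only [innerSL_apply_apply, inner_smul_right, orthonormal_iff_ite.1 he j i]
    by_cases h : i = j
    · subst h; simp
    · simp [h, Ne.symm h]
  have h := hv.mapL (innerSL ℂ v)
  have h2 := Complex.hasSum_re h
  convert h2 using 1
  · funext i
    rw [innerSL_apply_apply, inner_smul_right, ← inner_conj_symm, hcoeff, Complex.mul_conj']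
    norm_cast
  · rw [innerSL_apply_apply, inner_self_eq_norm_sq_to_K]
    norm_cast

theorem exists_continuousMap_hasSum_sq_norm {c : ℕ → ℂ} {ρ : ℝ} (hρ : 0 ≤ ρ)
    (hc : Summable fun n => ‖c n‖ * ρ ^ n) :
    ∃ φ : C(UnitAddCircle, ℂ),
      (∀ t : UnitAddCircle, HasSum (fun n => c n * (ρ * (t.toCircle : ℂ)) ^ n) (φ t)) ∧
      HasSum (fun n => (‖c n‖ * ρ ^ n) ^ 2)
        (‖ContinuousMap.toLp 2 AddCircle.haarAddCircle ℂ φ‖ ^ 2) := by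
  have hs : Summable fun n : ℕ => (c n * (ρ : ℂ) ^ n) • fourier (T := 1) n := by
    refine Summable.of_norm ?_
    simpa [norm_smul, fourier_norm, abs_of_nonneg hρ] using hc
  obtain ⟨φ, hφ⟩ := hs
  refine ⟨φ, fun t => ?_, ?_⟩
  · refine (hφ.mapL (ContinuousMap.evalCLM ℂ t)).congr_fun fun n => ?_
    simp [mul_pow, fourier_apply, mul_assoc, AddCircle.toCircle_nsmul]
  · have h := hφ.mapL (ContinuousMap.toLp 2 AddCircle.haarAddCircle ℂ)
    have ho : Orthonormal ℂ fun n : ℕ => fourierLp (T := 1) 2 (n : ℤ) :=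
      orthonormal_fourier.comp _ Nat.cast_injective
    simp only [map_smul] at h
    simpa [abs_of_nonneg hρ] using ho.hasSum_sq_norm h

theorem sum_sq_norm_coeff_le {c d : ℕ → ℂ} {ρ : ℝ} (hρ : 0 ≤ ρ)
    (hc : Summable fun n => ‖c n‖ * ρ ^ n) (hd : Summable fun n => ‖d n‖ * ρ ^ n)
    (h : ∀ z : ℂ, ‖z‖ = ρ → ‖∑' n, c n * z ^ n‖ ≤ ‖∑' n, d n * z ^ n‖) :
    ∑' n, (‖c n‖ * ρ ^ n) ^ 2 ≤ ∑' n, (‖d n‖ * ρ ^ n) ^ 2 ∧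
      Summable fun n => (‖c n‖ * ρ ^ n) ^ 2 := by
  obtain ⟨φ, hφ, hφs⟩ := exists_continuousMap_hasSum_sq_norm hρ hc
  obtain ⟨ψ, hψ, hψs⟩ := exists_continuousMap_hasSum_sq_norm hρ hd
  refine ⟨?_, hφs.summable⟩
  rw [hφs.tsum_eq, hψs.tsum_eq]
  gcongr
  apply MeasureTheory.Lp.norm_le_norm_of_ae_le
  filter_upwards [ContinuousMap.coeFn_toLp (p := 2) (𝕜 := ℂ) AddCircle.haarAddCircle φ,
    ContinuousMap.coeFn_toLp (p := 2) (𝕜 := ℂ) AddCircle.haarAddCircle ψ] with t h1 h2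
  rw [h1, h2, ← (hφ t).tsum_eq, ← (hψ t).tsum_eq]
  exact h _ (by rw [norm_mul, Circle.norm_coe, mul_one, Complex.norm_real, Real.norm_of_nonneg hρ])

theorem toeplitz_sum_sq_norm_le {f : ℂ → ℂ} {a : ℕ → ℂ}
    (hf : ∀ z : ℂ, ‖z‖ < 1 → HasSum (fun n : ℕ => a n * z ^ n) (f z))
    (hb : ∀ z : ℂ, ‖z‖ < 1 → ‖f z‖ ≤ 1) (x : ℕ → ℂ) {N : ℕ} (hx : ∀ n, N ≤ n → x n = 0)
    (M : ℕ) :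
    ∑ n ∈ Finset.range M, ‖∑ p ∈ Finset.HasAntidiagonal.antidiagonal n, a p.1 * x p.2‖ ^ 2 ≤
      ∑ n ∈ Finset.range N, ‖x n‖ ^ 2 := by
  set c : ℕ → ℂ := fun n => ∑ p ∈ Finset.HasAntidiagonal.antidiagonal n, a p.1 * x p.2 with hc
  have hprod (z : ℂ) (n : ℕ) : c n * z ^ n =
      ∑ p ∈ Finset.HasAntidiagonal.antidiagonal n, (a p.1 * z ^ p.1) * (x p.2 * z ^ p.2) := by
    rw [hc, Finset.sum_mul]
    refine Finset.sum_congr rfl fun p hp => ?_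
    rw [← Finset.HasAntidiagonal.mem_antidiagonal.1 hp, pow_add]
    ring
  have hx0 (z : ℂ) (n : ℕ) (hn : n ∉ Finset.range N) : x n * z ^ n = 0 := by
    rw [hx n (by simpa using hn), zero_mul]
  have hxs (z : ℂ) : Summable fun n => ‖x n * z ^ n‖ :=
    summable_of_ne_finset_zero (s := Finset.range N) fun n hn => by simp [hx0 z n hn]
  have has (z : ℂ) (hz : ‖z‖ < 1) : Summable fun n => ‖a n * z ^ n‖ :=
    (hf z hz).summable.norm
  have key (ρ : ℝ) (hρ : ρ ∈ Set.Ico (0 : ℝ) 1) :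
      ∑ n ∈ Finset.range M, (‖c n‖ * ρ ^ n) ^ 2 ≤
        ∑ n ∈ Finset.range N, (‖x n‖ * ρ ^ n) ^ 2 := by
    have hρn : ‖(ρ : ℂ)‖ = ρ := by simp [abs_of_nonneg hρ.1]
    have hcs : Summable fun n => ‖c n‖ * ρ ^ n := by
      have := summable_norm_sum_mul_antidiagonal_of_summable_norm
        (has ρ (hρn.trans_lt hρ.2)) (hxs ρ)
      simp only [← hprod, norm_mul, norm_pow, hρn] at this
      exact this
    have hds : Summable fun n => ‖x n‖ * ρ ^ n := by
      simpa [hρn, abs_of_nonneg hρ.1] using hxs ρ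
    obtain ⟨h1, h2⟩ := sum_sq_norm_coeff_le hρ.1 hcs hds fun z hz => by
      have hz1 : ‖z‖ < 1 := hz ▸ hρ.2
      simp only [hprod]
      rw [← tsum_mul_tsum_eq_tsum_sum_antidiagonal_of_summable_norm (has z hz1) (hxs z),
        (hf z hz1).tsum_eq, norm_mul]
      exact mul_le_of_le_one_left (norm_nonneg _) (hb z hz1)
    rw [tsum_eq_sum (f := fun n => (‖x n‖ * ρ ^ n) ^ 2) (s := Finset.range N)
      (fun n hn => by rw [hx n (by simpa using hn)]; simp)] at h1
    exact (h2.sum_le_tsum _ fun n _ => by positivity).trans h1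
  have lim (u : ℕ → ℂ) (K : ℕ) : Filter.Tendsto
      (fun ρ : ℝ => ∑ n ∈ Finset.range K, (‖u n‖ * ρ ^ n) ^ 2) (nhdsWithin 1 (Set.Iio 1))
      (nhds (∑ n ∈ Finset.range K, ‖u n‖ ^ 2)) := by
    have : Continuous fun ρ : ℝ => ∑ n ∈ Finset.range K, (‖u n‖ * ρ ^ n) ^ 2 := by fun_prop
    simpa using (this.tendsto 1).mono_left nhdsWithin_le_nhds
  exact le_of_tendsto_of_tendsto (lim c M) (lim x N)
    (Filter.eventually_of_mem (Ico_mem_nhdsLT one_pos) key)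

theorem reflected_toeplitz_sum_sq_norm_le {f : ℂ → ℂ} {a : ℕ → ℂ} (h0 : a 0 = 0)
    (hf : ∀ z : ℂ, ‖z‖ < 1 → HasSum (fun n : ℕ => a n * z ^ n) (f z))
    (hb : ∀ z : ℂ, ‖z‖ < 1 → ‖f z‖ ≤ 1) (K : ℕ) (y : ℕ → ℂ) :
    ∑ m ∈ Finset.range (K + 1),
        ‖∑ k ∈ Finset.range (m + 1), a (k + 1) * y (K - m + k)‖ ^ 2 ≤
      ∑ k ∈ Finset.range (K + 1), ‖y k‖ ^ 2 := by
  have h := toeplitz_sum_sq_norm_le hf hb (fun j => if j < K + 1 then y (K - j) else 0)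
    (N := K + 1) (fun n hn => if_neg (by omega)) (K + 1 + 1)
  rw [Finset.sum_range_succ'] at h
  rw [← Finset.sum_range_reflect (fun k => ‖y k‖ ^ 2)]
  refine le_trans ?_ (h.trans_eq ?_)
  · refine le_add_of_le_of_nonneg (Finset.sum_le_sum fun m hm => le_of_eq ?_) (by positivity)
    rw [Finset.Nat.sum_antidiagonal_succ, h0, zero_mul, zero_add,
      Finset.Nat.sum_antidiagonal_eq_sum_range_succ
        (fun k j => a (k + 1) * (if j < K + 1 then y (K - j) else 0))]
    congr 2
    refine Finset.sum_congr rfl fun k hk => ?_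
    simp only [Finset.mem_range] at hm hk
    rw [if_pos (by omega), show K - (m - k) = K - m + k by omega]
  · refine Finset.sum_congr rfl fun k hk => ?_
    rw [if_pos (Finset.mem_range.1 hk), show K + 1 - 1 - k = K - k by omega]

section CoefficientBounds

variable {b : ℕ → ℂ}

theorem sq_norm_add_sq_norm_le
    (hb : ∀ (K : ℕ) (y : ℕ → ℂ), ∑ m ∈ Finset.range (K + 1),
      ‖∑ k ∈ Finset.range (m + 1), b k * y (K - m + k)‖ ^ 2 ≤
        ∑ k ∈ Finset.range (K + 1), ‖y k‖ ^ 2)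
    {n K : ℕ} (hnK : n < K) (hK : 2 * n ≤ K) {s : ℂ} (hs : ‖s‖ = 1) (t : ℂ) :
    ‖b n * s + if K = 2 * n then b 0 * t else 0‖ ^ 2 +
        ‖(∑ k ∈ Finset.range n, ‖b k‖ ^ 2 : ℝ) + b n * t + b K * s‖ ^ 2 ≤
      1 + ‖t‖ ^ 2 := by
  set y : ℕ → ℂ := fun k =>
    if k = K then s else if k < n then (starRingEnd ℂ) (b k) else if k = n then t else 0 with hy
  have hyK : y K = s := by simp [hy]
  have hyn : y n = t := by simp [hy, hnK.ne]
  have hylt (k : ℕ) (hk : k < n) : y k = (starRingEnd ℂ) (b k) := by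
    simp [hy, hk, (hk.trans hnK).ne]
  have hygt (k : ℕ) (h1 : n < k) (h2 : k < K) : y k = 0 := by
    simp [hy, h2.ne, h1.not_gt, h1.ne']
  have split {M : Type} [AddCommMonoid M] (g : ℕ → M)
      (hg : ∀ k, n < k → k < K → g k = 0) :
      ∑ k ∈ Finset.range (K + 1), g k = ∑ k ∈ Finset.range n, g k + g n + g K := by
    rw [Finset.sum_range_succ, ← Finset.sum_range_succ g n]
    congr 1
    refine (Finset.sum_subset (Finset.range_mono hnK) fun k h1 h2 => ?_).symm
    simp only [Finset.mem_range] at h1 h2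
    exact hg k (by omega) h1
  have hnorm : ∑ k ∈ Finset.range (K + 1), ‖y k‖ ^ 2 =
      ∑ k ∈ Finset.range n, ‖b k‖ ^ 2 + ‖t‖ ^ 2 + 1 := by
    rw [split _ fun k h1 h2 => by simp [hygt k h1 h2], hyK, hyn, hs, one_pow]
    congr 2
    refine Finset.sum_congr rfl fun k hk => ?_
    rw [hylt k (Finset.mem_range.1 hk), RCLike.norm_conj]
  have hlast : ∑ k ∈ Finset.range (K + 1), b k * y (K - K + k) =
      (∑ k ∈ Finset.range n, ‖b k‖ ^ 2 : ℝ) + b n * t + b K * s := by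
    simp only [Nat.sub_self, zero_add]
    rw [split _ fun k h1 h2 => by simp [hygt k h1 h2], hyK, hyn, Complex.ofReal_sum]
    congr 2
    refine Finset.sum_congr rfl fun k hk => ?_
    rw [hylt k (Finset.mem_range.1 hk), Complex.mul_conj', Complex.ofReal_pow]
  have hfirst (m : ℕ) (hm : m < n) :
      ∑ k ∈ Finset.range (m + 1), b k * y (K - m + k) = b m * s := by
    rw [Finset.sum_range_succ, show K - m + m = K by omega, hyK, Finset.sum_eq_zero, zero_add]
    intro k hk
    have := Finset.mem_range.1 hk
    rw [hygt _ (by omega) (by omega), mul_zero]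
  have hmid : ∑ k ∈ Finset.range (n + 1), b k * y (K - n + k) =
      b n * s + if K = 2 * n then b 0 * t else 0 := by
    rw [Finset.sum_range_succ, show K - n + n = K by omega, hyK, add_comm]
    congr 1
    split_ifs with h
    · rw [Finset.sum_eq_single 0, show K - n + 0 = n by omega, hyn]
      · intro k hk hk0
        have := Finset.mem_range.1 hk
        rw [hygt _ (by omega) (by omega), mul_zero]
      · intro h0
        simp only [Finset.mem_range] at h0
        omega
    · refine Finset.sum_eq_zero fun k hk => ?_
      have := Finset.mem_range.1 hk
      rw [hygt _ (by omega) (by omega), mul_zero]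
  have h := hb K y
  rw [hnorm, Finset.sum_range_succ, hlast] at h
  have hsub := Finset.sum_le_sum_of_subset_of_nonneg
    (f := fun m => ‖∑ k ∈ Finset.range (m + 1), b k * y (K - m + k)‖ ^ 2)
    (Finset.range_mono (Nat.succ_le_of_lt hnK)) fun _ _ _ => by positivity
  rw [Nat.succ_eq_add_one, Finset.sum_range_succ, hmid, Finset.sum_congr rfl fun m hm => by
    rw [hfirst m (Finset.mem_range.1 hm), norm_mul, hs, mul_one]] at hsub
  linarith

theorem norm_odd_coeff_add_sum_le_one
    (hb : ∀ (K : ℕ) (y : ℕ → ℂ), ∑ m ∈ Finset.range (K + 1),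
      ‖∑ k ∈ Finset.range (m + 1), b k * y (K - m + k)‖ ^ 2 ≤
        ∑ k ∈ Finset.range (K + 1), ‖y k‖ ^ 2) (n : ℕ) :
    ‖b (2 * n + 1)‖ + ∑ k ∈ Finset.range (n + 1), ‖b k‖ ^ 2 ≤ 1 := by
  obtain ⟨s, hs, hsb⟩ := RCLike.exists_norm_eq_mul_self (b (2 * n + 1))
  have h := sq_norm_add_sq_norm_le hb (n := n) (K := 2 * n + 1) (by omega) (by omega) hs
    ((starRingEnd ℂ) (b n))
  have hlast : (∑ k ∈ Finset.range n, ‖b k‖ ^ 2 : ℝ) + b n * (starRingEnd ℂ) (b n) +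
      b (2 * n + 1) * s =
      (∑ k ∈ Finset.range n, ‖b k‖ ^ 2 + ‖b n‖ ^ 2 + ‖b (2 * n + 1)‖ : ℝ) := by
    rw [mul_comm _ s, ← hsb, Complex.mul_conj']
    push_cast
    rfl
  rw [if_neg (by omega), add_zero, norm_mul, hs, mul_one, RCLike.norm_conj, hlast,
    Complex.norm_real, Real.norm_eq_abs, sq_abs] at h
  have h3 : ∑ k ∈ Finset.range n, ‖b k‖ ^ 2 + ‖b n‖ ^ 2 + ‖b (2 * n + 1)‖ ≤ 1 :=
    (sq_le_one_iff₀ (by positivity)).1 (by linarith)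
  rw [Finset.sum_range_succ]
  linarith

theorem norm_even_coeff_add_sum_le_one
    (hb : ∀ (K : ℕ) (y : ℕ → ℂ), ∑ m ∈ Finset.range (K + 1),
      ‖∑ k ∈ Finset.range (m + 1), b k * y (K - m + k)‖ ^ 2 ≤
        ∑ k ∈ Finset.range (K + 1), ‖y k‖ ^ 2) {n : ℕ} (hn : 0 < n) :
    ‖b (2 * n)‖ + ∑ k ∈ Finset.range n, ‖b k‖ ^ 2 + ‖b n‖ ^ 2 / (1 + ‖b 0‖) ≤ 1 := by
  obtain ⟨s, hs, hsb⟩ := RCLike.exists_norm_eq_mul_self (b (2 * n))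
  set τ : ℝ := 1 / (1 + ‖b 0‖) with hτ
  have hτ0 : 0 ≤ τ := by positivity
  have hτ1 : 1 - τ * ‖b 0‖ = τ := by rw [hτ]; field_simp; ring
  have h := sq_norm_add_sq_norm_le hb (n := n) (K := 2 * n) (by omega) le_rfl hs
    (τ * (starRingEnd ℂ) (b n))
  have hlow : ‖b n‖ * τ ≤ ‖b n * s + b 0 * (τ * (starRingEnd ℂ) (b n))‖ := by
    refine le_trans (le_of_eq ?_) (norm_sub_le_norm_add _ _)
    rw [norm_mul, norm_mul, norm_mul, hs, RCLike.norm_conj, Complex.norm_real,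
      Real.norm_of_nonneg hτ0]
    linear_combination (-‖b n‖) * hτ1
  have hlow2 := pow_le_pow_left₀ (by positivity) hlow 2
  have hlast : (∑ k ∈ Finset.range n, ‖b k‖ ^ 2 : ℝ) + b n * (τ * (starRingEnd ℂ) (b n)) +
      b (2 * n) * s = (∑ k ∈ Finset.range n, ‖b k‖ ^ 2 + τ * ‖b n‖ ^ 2 + ‖b (2 * n)‖ : ℝ) := by
    rw [mul_comm _ s, ← hsb, mul_left_comm, Complex.mul_conj']
    push_cast
    rfl
  rw [if_pos rfl, hlast, norm_mul (τ : ℂ), RCLike.norm_conj, Complex.norm_real, Complex.norm_real,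
    Real.norm_of_nonneg hτ0, Real.norm_eq_abs, sq_abs, mul_comm τ ‖b n‖] at h
  have h3 : ∑ k ∈ Finset.range n, ‖b k‖ ^ 2 + τ * ‖b n‖ ^ 2 + ‖b (2 * n)‖ ≤ 1 :=
    (sq_le_one_iff₀ (by positivity)).1 (by linarith)
  rw [div_eq_mul_one_div, ← hτ]
  linarith

theorem sum_range_add_sum_sq_range_le
    (hodd : ∀ n, ‖b (2 * n + 1)‖ + ∑ k ∈ Finset.range (n + 1), ‖b k‖ ^ 2 ≤ 1)
    (heven : ∀ n, 0 < n →
      ‖b (2 * n)‖ + ∑ k ∈ Finset.range n, ‖b k‖ ^ 2 + ‖b n‖ ^ 2 / (1 + ‖b 0‖) ≤ 1)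
    {r : ℝ} (hr0 : 0 ≤ r) (hr1 : r < 1) (K : ℕ) :
    ∑ n ∈ Finset.range (2 * K + 1), ‖b n‖ * r ^ n +
        (1 / (1 + ‖b 0‖) + r / (1 - r)) *
          ∑ n ∈ Finset.range (K + 1), ‖b n‖ ^ 2 * r ^ (2 * n) ≤
      ‖b 0‖ + ‖b 0‖ ^ 2 / (1 + ‖b 0‖) + r / (1 - r) -
        (1 - ∑ n ∈ Finset.range (K + 1), ‖b n‖ ^ 2) * r ^ (2 * K + 1) / (1 - r) := by
  have hr : 1 - r ≠ 0 := by linarith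
  have hA : 1 + ‖b 0‖ ≠ 0 := by positivity
  induction K with
  | zero =>
    apply le_of_eq
    simp
    field_simp
    ring
  | succ K ih =>
    have h1 := mul_le_mul_of_nonneg_right (hodd K) (pow_nonneg hr0 (2 * K + 1))
    have h2 := mul_le_mul_of_nonneg_right (heven (K + 1) K.succ_pos)
      (pow_nonneg hr0 (2 * (K + 1)))
    rw [show 2 * (K + 1) + 1 = 2 * K + 1 + 1 + 1 by ring, Finset.sum_range_succ,
      Finset.sum_range_succ, Finset.sum_range_succ (fun n => ‖b n‖ ^ 2 * r ^ (2 * n)),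
      Finset.sum_range_succ (fun n => ‖b n‖ ^ 2) (K + 1)]
    rw [show 2 * K + 1 + 1 = 2 * (K + 1) by ring]
    set S := ∑ n ∈ Finset.range (K + 1), ‖b n‖ ^ 2
    set q := ‖b (K + 1)‖ ^ 2
    have key : (1 - S) * r ^ (2 * K + 1) / (1 - r) -
        (1 - (S + q)) * r ^ (2 * (K + 1) + 1) / (1 - r) =
        (1 - S) * r ^ (2 * K + 1) + (1 - S) * r ^ (2 * (K + 1)) +
          q * (r / (1 - r) * r ^ (2 * (K + 1))) := by
      field_simp
      ring
    have key2 : q / (1 + ‖b 0‖) = q * (1 / (1 + ‖b 0‖)) := by ring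
    rw [key2] at h2
    linarith

theorem tsum_add_tsum_sq_le
    (hodd : ∀ n, ‖b (2 * n + 1)‖ + ∑ k ∈ Finset.range (n + 1), ‖b k‖ ^ 2 ≤ 1)
    (heven : ∀ n, 0 < n →
      ‖b (2 * n)‖ + ∑ k ∈ Finset.range n, ‖b k‖ ^ 2 + ‖b n‖ ^ 2 / (1 + ‖b 0‖) ≤ 1)
    {r : ℝ} (hr0 : 0 ≤ r) (hr1 : r < 1) :
    ∑' n, ‖b n‖ * r ^ n +
        (1 / (1 + ‖b 0‖) + r / (1 - r)) * ∑' n, ‖b n‖ ^ 2 * r ^ (2 * n) ≤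
      ‖b 0‖ + ‖b 0‖ ^ 2 / (1 + ‖b 0‖) + r / (1 - r) := by
  have hsum (n : ℕ) : ∑ k ∈ Finset.range (n + 1), ‖b k‖ ^ 2 ≤ 1 := by
    linarith [hodd n, norm_nonneg (b (2 * n + 1))]
  have hle (n : ℕ) : ‖b n‖ ^ 2 ≤ 1 :=
    (Finset.single_le_sum (f := fun k => ‖b k‖ ^ 2) (fun _ _ => by positivity)
      (Finset.self_mem_range_succ n)).trans (hsum n)
  have hs1 : Summable fun n => ‖b n‖ * r ^ n :=
    (summable_geometric_of_lt_one hr0 hr1).of_nonneg_of_le (fun n => by positivity) fun n =>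
      mul_le_of_le_one_left (by positivity) ((sq_le_one_iff₀ (norm_nonneg _)).1 (hle n))
  have hs2 : Summable fun n => ‖b n‖ ^ 2 * r ^ (2 * n) := by
    refine (summable_geometric_of_lt_one (sq_nonneg r) (by nlinarith)).of_nonneg_of_le
      (fun n => by positivity) fun n => ?_
    rw [pow_mul]
    exact mul_le_of_le_one_left (by positivity) (hle n)
  have t1 : Filter.Tendsto (fun K : ℕ => 2 * K + 1) Filter.atTop Filter.atTop :=
    Filter.tendsto_atTop_mono (fun K => by rw [id_eq]; omega) Filter.tendsto_id
  refine le_of_tendsto' ((hs1.hasSum.tendsto_sum_nat.comp t1).add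
    ((hs2.hasSum.tendsto_sum_nat.comp (Filter.tendsto_add_atTop_nat 1)).const_mul _)) fun K => ?_
  refine (sum_range_add_sum_sq_range_le hodd heven hr0 hr1 K).trans (sub_le_self _ ?_)
  have : 0 < 1 - r := by linarith
  have := sub_nonneg.2 (hsum K)
  positivity

end CoefficientBounds

theorem lt_one_and_quadratic_nonneg_of_le_radius {A r : ℝ} (hA : 0 ≤ A) (hr0 : 0 < r)
    (hr : r ≤ 2 * (1 + A) / (1 + 2 * A + 2 * A ^ 2 + √(4 * A ^ 4 + 8 * A + 5))) :
    r < 1 ∧ 0 ≤ (1 + A) - r * (1 + 2 * A + 2 * A ^ 2) - r ^ 2 * (1 - 2 * A ^ 2) := by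
  rw [le_div_iff₀ (by positivity)] at hr
  set w := √(4 * A ^ 4 + 8 * A + 5)
  have hw : w ^ 2 = 4 * A ^ 4 + 8 * A + 5 := Real.sq_sqrt (by positivity)
  have hw0 : 0 ≤ w := Real.sqrt_nonneg _
  have hw1 : 1 < w := by
    have : 0 ≤ A ^ 4 := by positivity
    nlinarith
  constructor
  · by_contra! h
    nlinarith [sq_nonneg A]
  · have h1 : (r * w) ^ 2 ≤ (2 * (1 + A) - r * (1 + 2 * A + 2 * A ^ 2)) ^ 2 :=
      pow_le_pow_left₀ (by positivity) (by linarith) 2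
    rw [mul_pow, hw] at h1
    refine nonneg_of_mul_nonneg_right (a := 4 * (1 + A)) ?_ (by positivity)
    linarith


/-- Theorem 3(c): if `f(z) = Σ_{n≥1} aₙ zⁿ` is analytic in the unit disk with `f(0) = 0`,
`|f| ≤ 1`, and `a = |a₁|`, then for `0 < r ≤ r(a) = 2(1+a)/(1+2a+2a²+√(4a⁴+8a+5))`,
`Σ_{n≥1} |aₙ| rⁿ + (r⁻¹/(1+a) + 1/(1-r)) Σ_{n≥1} |aₙ|² r^{2n} ≤ 1`. -/
theorem stmt_10 (f : ℂ → ℂ) (a : ℕ → ℂ) (h0 : a 0 = 0)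
    (hf : ∀ z : ℂ, ‖z‖ < 1 → HasSum (fun n : ℕ => a n * z ^ n) (f z))
    (hb : ∀ z : ℂ, ‖z‖ < 1 → ‖f z‖ ≤ 1)
    (r : ℝ) (hr0 : 0 < r)
    (hr1 : r ≤ 2 * (1 + ‖a 1‖) /
      (1 + 2 * ‖a 1‖ + 2 * ‖a 1‖ ^ 2 + Real.sqrt (4 * ‖a 1‖ ^ 4 + 8 * ‖a 1‖ + 5))) :
    (∑' n : ℕ, ‖a (n + 1)‖ * r ^ (n + 1)) +
      (r⁻¹ / (1 + ‖a 1‖) + 1 / (1 - r)) *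
        ∑' n : ℕ, ‖a (n + 1)‖ ^ 2 * r ^ (2 * (n + 1)) ≤ 1 := by
  obtain ⟨hr, hquad⟩ := lt_one_and_quadratic_nonneg_of_le_radius (norm_nonneg (a 1)) hr0 hr1
  have hT := reflected_toeplitz_sum_sq_norm_le h0 hf hb
  have h := tsum_add_tsum_sq_le (b := fun n => a (n + 1)) (norm_odd_coeff_add_sum_le_one hT)
    (fun n hn => norm_even_coeff_add_sum_le_one hT hn) hr0.le hr
  have e1 : ∑' n : ℕ, ‖a (n + 1)‖ * r ^ (n + 1) = r * ∑' n : ℕ, ‖a (n + 1)‖ * r ^ n := by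
    rw [← tsum_mul_left]
    exact tsum_congr fun n => by ring
  have e2 : ∑' n : ℕ, ‖a (n + 1)‖ ^ 2 * r ^ (2 * (n + 1)) =
      r ^ 2 * ∑' n : ℕ, ‖a (n + 1)‖ ^ 2 * r ^ (2 * n) := by
    rw [← tsum_mul_left]
    exact tsum_congr fun n => by ring
  rw [e1, e2]
  have hr' : 0 < 1 - r := by linarith
  have hA : 0 < 1 + ‖a 1‖ := by positivity
  have h2 := mul_le_mul_of_nonneg_left h hr0.le
  rw [zero_add] at h2
  refine (le_of_eq ?_).trans (h2.trans ?_)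
  · field_simp
  · rw [← sub_nonneg]
    convert div_nonneg hquad (mul_pos hA hr').le using 1
    field_simp
    ring
end

section
/- Fix a ∈ (0,1) and let f(z) = z(a−z)/(1−az), with coefficients a_1 = a and a_n = −(1−a²)a^{n−2} for n ≥ 2. Then for every r ∈ (0,1), Σ_{n=1}^∞ |a_n| r^n + (r^{−1}/(1+a) + 1/(1−r)) · Σ_{n=1}^∞ |a_n|² r^{2n} = ar + r²(1−a²)/(1−r) + a²r(1+ar)/((1+a)(1−r)), and this quantity exceeds 1 if and only if B(a,r) := r²(2a² − 1) − r(1 + 2a + 2a²) + 1 + a < 0, which happens exactly when r > r(a) = 2(1+a)/(1 + 2a + 2a² + √(4a⁴ + 8a + 5)). Hence the radius r(a) in part (c) of the theorem is sharp for each a ∈ [0,1). -/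
/-- A shifted geometric tail: a sequence with first term `x` and then `y, y q, y q², …`. -/
lemma hasSum_of_geometric_tail {u : ℕ → ℝ} {x y q : ℝ} (hq0 : 0 ≤ q) (hq1 : q < 1)
    (hu0 : u 0 = x) (hu : ∀ n, u (n + 1) = y * q ^ n) :
    HasSum u (x + y / (1 - q)) := by
  rw [← hasSum_nat_add_iff' 1]
  simpa [hu0, hu, div_eq_mul_inv] using (hasSum_geometric_of_lt_one hq0 hq1).mul_left y

/-- The quadratic `B(a, ·)` is negative on `(0, 1)` exactly beyond its root `r(a)`. -/
lemma quadratic_neg_iff_radius_lt {a r : ℝ} (ha0 : 0 < a) (hr0 : 0 < r) (hr1 : r < 1) :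
    r ^ 2 * (2 * a ^ 2 - 1) - r * (1 + 2 * a + 2 * a ^ 2) + 1 + a < 0 ↔
      2 * (1 + a) / (1 + 2 * a + 2 * a ^ 2 + Real.sqrt (4 * a ^ 4 + 8 * a + 5)) < r := by
  set s := Real.sqrt (4 * a ^ 4 + 8 * a + 5)
  have hs2 : s ^ 2 = 4 * a ^ 4 + 8 * a + 5 := Real.sq_sqrt (by positivity)
  have hs0 : 0 ≤ s := Real.sqrt_nonneg _
  have hlt : 2 * a ^ 2 - 1 < s := Real.lt_sqrt_of_sq_lt (by nlinarith [sq_nonneg a])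
  have hfac : (2 * (1 + a) - r * (1 + 2 * a + 2 * a ^ 2 + s)) *
      (2 * (1 + a) - r * (1 + 2 * a + 2 * a ^ 2 - s)) =
      4 * (1 + a) * (r ^ 2 * (2 * a ^ 2 - 1) - r * (1 + 2 * a + 2 * a ^ 2) + 1 + a) := by
    linear_combination (-r ^ 2) * hs2
  have hpos : 0 < 2 * (1 + a) - r * (1 + 2 * a + 2 * a ^ 2 - s) := by
    have h₁ : 0 < (1 + a) * (1 - r) := mul_pos (by linarith) (by linarith)
    have h₂ : 0 < r * (s - (2 * a ^ 2 - 1)) := mul_pos hr0 (by linarith)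
    linarith
  have hpos' : 0 < 4 * (1 + a) := by positivity
  rw [div_lt_iff₀ (by positivity), ← sub_neg (a := 2 * (1 + a))]
  constructor <;> intro h
  · exact neg_of_mul_neg_left (hfac ▸ mul_neg_of_pos_of_neg hpos' h) hpos.le
  · exact neg_of_mul_neg_right (hfac ▸ mul_neg_of_neg_of_pos h hpos) hpos'.le

/-- Sharpness of the radius `r(a)` in Theorem 3(c): for `f(z) = z(a-z)/(1-az)` with
coefficients `c 1 = a`, `c n = -(1-a²)a^{n-2}` for `n ≥ 2`, and any `r ∈ (0,1)`, the quantity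
`Σ_{n≥1} |cₙ| rⁿ + (r⁻¹/(1+a) + 1/(1-r)) Σ_{n≥1} |cₙ|² r^{2n}` equals
`ar + r²(1-a²)/(1-r) + a²r(1+ar)/((1+a)(1-r))`; it exceeds `1` iff
`B(a,r) = r²(2a²-1) - r(1+2a+2a²) + 1 + a < 0`, which holds
iff `r > r(a) = 2(1+a)/(1+2a+2a²+√(4a⁴+8a+5))`. -/
theorem stmt_11 (a : ℝ) (ha0 : 0 < a) (ha1 : a < 1)
    (c : ℕ → ℝ) (hc1 : c 1 = a)
    (hc : ∀ n : ℕ, 2 ≤ n → c n = -(1 - a ^ 2) * a ^ (n - 2))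
    (r : ℝ) (hr0 : 0 < r) (hr1 : r < 1) :
    ((∑' n : ℕ, |c (n + 1)| * r ^ (n + 1)) +
        (r⁻¹ / (1 + a) + 1 / (1 - r)) *
          ∑' n : ℕ, |c (n + 1)| ^ 2 * r ^ (2 * (n + 1)) =
      a * r + r ^ 2 * (1 - a ^ 2) / (1 - r) +
        a ^ 2 * r * (1 + a * r) / ((1 + a) * (1 - r))) ∧
    (1 < (∑' n : ℕ, |c (n + 1)| * r ^ (n + 1)) +
        (r⁻¹ / (1 + a) + 1 / (1 - r)) *
          ∑' n : ℕ, |c (n + 1)| ^ 2 * r ^ (2 * (n + 1)) ↔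
      r ^ 2 * (2 * a ^ 2 - 1) - r * (1 + 2 * a + 2 * a ^ 2) + 1 + a < 0) ∧
    (r ^ 2 * (2 * a ^ 2 - 1) - r * (1 + 2 * a + 2 * a ^ 2) + 1 + a < 0 ↔
      2 * (1 + a) / (1 + 2 * a + 2 * a ^ 2 + Real.sqrt (4 * a ^ 4 + 8 * a + 5)) < r) := by
  have har0 : 0 < a * r := mul_pos ha0 hr0
  have har1 : a * r < 1 := by nlinarith
  have ha2 : 0 < 1 - a ^ 2 := by nlinarith
  have hr : 0 < 1 - r := by linarith
  have har : 0 < 1 - a * r := by linarith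
  have hc_abs : ∀ n, |c (n + 1 + 1)| = (1 - a ^ 2) * a ^ n := fun n ↦ by
    rw [hc _ (by omega), neg_mul, abs_neg, abs_of_nonneg (by positivity)]
    simp
  have hsum : ∑' n : ℕ, |c (n + 1)| * r ^ (n + 1) =
      a * r + (1 - a ^ 2) * r ^ 2 / (1 - a * r) := by
    refine (hasSum_of_geometric_tail har0.le har1 ?_ fun n ↦ ?_).tsum_eq
    · simp [hc1, abs_of_pos ha0]
    · rw [hc_abs]
      ring
  have hsum_sq : ∑' n : ℕ, |c (n + 1)| ^ 2 * r ^ (2 * (n + 1)) =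
      a ^ 2 * r ^ 2 + (1 - a ^ 2) ^ 2 * r ^ 4 / (1 - (a * r) ^ 2) := by
    refine (hasSum_of_geometric_tail (sq_nonneg _) (by nlinarith) ?_ fun n ↦ ?_).tsum_eq
    · simp [hc1]
    · rw [hc_abs]
      ring
  have hvalue : (∑' n : ℕ, |c (n + 1)| * r ^ (n + 1)) +
        (r⁻¹ / (1 + a) + 1 / (1 - r)) *
          ∑' n : ℕ, |c (n + 1)| ^ 2 * r ^ (2 * (n + 1)) =
      a * r + r ^ 2 * (1 - a ^ 2) / (1 - r) +
        a ^ 2 * r * (1 + a * r) / ((1 + a) * (1 - r)) := by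
    rw [hsum, hsum_sq, show 1 - (a * r) ^ 2 = (1 - a * r) * (1 + a * r) by ring]
    have h₁ : 1 + a ≠ 0 := by positivity
    have h₂ : 1 + a * r ≠ 0 := by positivity
    have h₃ := hr.ne'
    have h₄ := har.ne'
    field_simp
    ring
  refine ⟨hvalue, ?_, quadratic_neg_iff_radius_lt ha0 hr0 hr1⟩
  have hdiff : a * r + r ^ 2 * (1 - a ^ 2) / (1 - r) +
        a ^ 2 * r * (1 + a * r) / ((1 + a) * (1 - r)) - 1 =
      -(r ^ 2 * (2 * a ^ 2 - 1) - r * (1 + 2 * a + 2 * a ^ 2) + 1 + a) /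
        ((1 + a) * (1 - r)) := by
    have h₁ : 1 + a ≠ 0 := by positivity
    have h₃ := hr.ne'
    field_simp
    ring
  rw [hvalue, ← sub_pos, hdiff, div_pos_iff_of_pos_right (by positivity), neg_pos]
end
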